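/- arXiv:1904.11369 — 8 statements merged into one kernel-verified Lean document; each statement's English description precedes it below -/
import Mathlib

section
/- Let d be an integer with d ≡ u (mod 75) for some u ∈ {7, 12, 17, 22, 32, 37, 42, 47, 57, 62, 67, 72}. Then there are no natural numbers n, m with C(n,2) = C(m,4) + d. -/
theorem two_mul_choose_two_int (n : ℕ) : 2 * (n.choose 2 : ℤ) = n * (n - 1) := by
  have h := descPochhammer_eval_eq_descFactorial ℤ n 2
  rw [Nat.descFactorial_eq_factorial_mul_choose] at h
  simpa [descPochhammer_succ_right, Nat.factorial] using h.symm

theorem twentyFour_mul_choose_four_int (m : ℕ) :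
    24 * (m.choose 4 : ℤ) = m * (m - 1) * (m - 2) * (m - 3) := by
  have h := descPochhammer_eval_eq_descFactorial ℤ m 4
  rw [Nat.descFactorial_eq_factorial_mul_choose] at h
  simpa [descPochhammer_succ_right, Nat.factorial] using h.symm

/-- Since `3` is not a square modulo `5`, the form `3 * x ^ 2 - y ^ 2` is anisotropic there. -/
theorem five_dvd_of_five_dvd_three_mul_sq_sub_sq {x y : ℤ} (h : 5 ∣ 3 * x ^ 2 - y ^ 2) :
    5 ∣ x ∧ 5 ∣ y := by
  have key : ∀ a b : ZMod 5, 3 * a ^ 2 - b ^ 2 = 0 → a = 0 ∧ b = 0 := by decide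
  have hz := (ZMod.intCast_zmod_eq_zero_iff_dvd (3 * x ^ 2 - y ^ 2) 5).2 h
  push_cast at hz
  obtain ⟨hx, hy⟩ := key x y hz
  exact ⟨(ZMod.intCast_zmod_eq_zero_iff_dvd x 5).1 hx, (ZMod.intCast_zmod_eq_zero_iff_dvd y 5).1 hy⟩

theorem binomial_eq_2_4_no_solutions_mod_75
    (d : ℤ)
    (hd : ∃ u ∈ ({7, 12, 17, 22, 32, 37, 42, 47, 57, 62, 67, 72} : Finset ℤ),
        d ≡ u [ZMOD 75]) :
    ¬ ∃ n m : ℕ, (n.choose 2 : ℤ) = (m.choose 4 : ℤ) + d := by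
  rintro ⟨n, m, h⟩
  have hmod : d % 5 = 2 ∧ d % 25 ≠ 2 := by
    obtain ⟨u, hu, hdu⟩ := hd
    simp only [Finset.mem_insert, Finset.mem_singleton] at hu
    unfold Int.ModEq at hdu
    omega
  have heq : 3 * (2 * n - 1 : ℤ) ^ 2 - (m ^ 2 - 3 * m + 1 : ℤ) ^ 2 = 2 + 24 * d := by
    linear_combination 24 * h - 12 * two_mul_choose_two_int n + twentyFour_mul_choose_four_int m
  obtain ⟨⟨a, ha⟩, b, hb⟩ :=
    five_dvd_of_five_dvd_three_mul_sq_sub_sq (heq ▸ (by omega : (5 : ℤ) ∣ 2 + 24 * d))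
  rw [ha, hb] at heq
  have hdvd : 25 * (3 * a ^ 2 - b ^ 2) = 2 + 24 * d := by linear_combination heq
  omega
end

section
/- Let d be an integer with 1 ≤ d ≤ 20 and let n, m be natural numbers with n ≥ 3 and m ≥ 3. Then C(n,3) = C(m,3) + d holds if and only if (d, n, m) is one of the following triples: (3, 4, 3), (6, 5, 4), (9, 5, 3), (10, 6, 5), (15, 7, 6), (16, 6, 4), (19, 6, 3). -/
theorem binomial_eq_3_3 (d : ℤ) (hd1 : 1 ≤ d) (hd2 : d ≤ 20)
    (n m : ℕ) (hn : 3 ≤ n) (hm : 3 ≤ m) :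
    (n.choose 3 : ℤ) = (m.choose 3 : ℤ) + d ↔
      (d = 3 ∧ n = 4 ∧ m = 3) ∨
      (d = 6 ∧ n = 5 ∧ m = 4) ∨
      (d = 9 ∧ n = 5 ∧ m = 3) ∨
      (d = 10 ∧ n = 6 ∧ m = 5) ∨
      (d = 15 ∧ n = 7 ∧ m = 6) ∨
      (d = 16 ∧ n = 6 ∧ m = 4) ∨
      (d = 19 ∧ n = 6 ∧ m = 3) := by
  constructor
  · intro h
    have hmn : m + 1 ≤ n := by
      by_contra! hlt
      have := Nat.choose_le_choose 3 (Nat.le_of_lt_succ hlt)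
      omega
    have hm6 : m ≤ 6 := by
      by_contra! hlt
      have hstep := Nat.choose_le_choose 3 hmn
      rw [show (m + 1).choose 3 = m.choose 2 + m.choose 3 from Nat.choose_succ_succ' m 2] at hstep
      have h21 : Nat.choose 7 2 ≤ m.choose 2 := Nat.choose_le_choose 2 hlt
      rw [show Nat.choose 7 2 = 21 by decide] at h21
      omega
    have hn7 : n ≤ 7 := by
      by_contra! hlt
      have h20 : m.choose 3 ≤ Nat.choose 6 3 := Nat.choose_le_choose 3 hm6
      have h56 : Nat.choose 8 3 ≤ n.choose 3 := Nat.choose_le_choose 3 hlt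
      rw [show Nat.choose 6 3 = 20 by decide] at h20
      rw [show Nat.choose 8 3 = 56 by decide] at h56
      omega
    interval_cases m <;> interval_cases n <;> norm_num [Nat.choose] at h ⊢ <;> omega
  · rintro (⟨rfl, rfl, rfl⟩ | ⟨rfl, rfl, rfl⟩ | ⟨rfl, rfl, rfl⟩ | ⟨rfl, rfl, rfl⟩ |
      ⟨rfl, rfl, rfl⟩ | ⟨rfl, rfl, rfl⟩ | ⟨rfl, rfl, rfl⟩) <;> decide
end

section
/- Let d be an integer with 1 ≤ d ≤ 20 and let n, m be natural numbers with n ≥ 5 and m ≥ 5. Then C(n,5) = C(m,5) + d holds if and only if (d, n, m) is one of the following triples: (5, 6, 5), (15, 7, 6), (20, 7, 5). -/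
theorem binomial_eq_5_5 (d : ℤ) (hd1 : 1 ≤ d) (hd2 : d ≤ 20)
    (n m : ℕ) (hn : 5 ≤ n) (hm : 5 ≤ m) :
    (n.choose 5 : ℤ) = (m.choose 5 : ℤ) + d ↔
      (d = 5 ∧ n = 6 ∧ m = 5) ∨
      (d = 15 ∧ n = 7 ∧ m = 6) ∨
      (d = 20 ∧ n = 7 ∧ m = 5) := by
  constructor
  · intro h
    have hmn : m < n := by
      by_contra! hle
      have := Nat.choose_le_choose 5 hle
      omega
    have hm6 : m ≤ 6 := by
      by_contra! hlt
      have hsucc : (m + 1).choose 5 ≤ n.choose 5 := Nat.choose_le_choose 5 hmn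
      have hpascal : (m + 1).choose 5 = m.choose 4 + m.choose 5 := Nat.choose_succ_succ m 4
      have hfour : Nat.choose 7 4 ≤ m.choose 4 := Nat.choose_le_choose 4 hlt
      have hval : Nat.choose 7 4 = 35 := by decide
      omega
    have hn7 : n ≤ 7 := by
      by_contra! hlt
      have hle_n : Nat.choose 8 5 ≤ n.choose 5 := Nat.choose_le_choose 5 hlt
      have hle_m : m.choose 5 ≤ Nat.choose 6 5 := Nat.choose_le_choose 5 hm6
      have hval8 : Nat.choose 8 5 = 56 := by decide
      have hval6 : Nat.choose 6 5 = 6 := by decide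
      omega
    interval_cases m <;> interval_cases n <;> norm_num [Nat.choose] at h ⊢ <;> omega
  · rintro (⟨rfl, rfl, rfl⟩ | ⟨rfl, rfl, rfl⟩ | ⟨rfl, rfl, rfl⟩) <;> norm_num [Nat.choose]
end

section
/- Let f₁, f₂ ∈ ℚ[X] be polynomials with deg f₁ = 2 and deg f₂ = 3. Then the polynomial identity B(f₁,3) + B(X,2) = B(f₂,2) holds in ℚ[X] if and only if the pair (f₁(X), f₂(X)) or the pair (f₁(1−X), f₂(1−X)) equals one of the following three pairs: (12X² − 12X + 3, −24X³ + 36X² − 15X + 2), (12X² − 12X + 5, −24X³ + 36X² − 21X + 5), ((12X² − 12X + 7)/4, (−24X³ + 36X² − 18X + 7)/8). -/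
open Polynomial

/-- The polynomial binomial coefficient `B(f,k) = f(f-1)⋯(f-k+1)/k!` in `ℚ[X]`. -/
noncomputable def polyBinom (f : Polynomial ℚ) (k : ℕ) : Polynomial ℚ :=
  C ((k.factorial : ℚ)⁻¹) * ∏ i ∈ Finset.range k, (f - (i : Polynomial ℚ))

/-- A rational parametrization of `w² = 4/3 (y³ - y) + t²` with `y` quadratic and `w` cubic in `t`
has, up to the signs of `t` and `w`, one of three shapes. -/
theorem parametrization_coeffs {a b c p q r w : ℚ} (ha : a ≠ 0) (hp : p ≠ 0)
    (h : ∀ t : ℚ, (p * t ^ 3 + q * t ^ 2 + r * t + w) ^ 2 =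
      4 / 3 * ((a * t ^ 2 + b * t + c) ^ 3 - (a * t ^ 2 + b * t + c)) + t ^ 2) :
    b = 0 ∧ q = 0 ∧ w = 0 ∧ ∃ s : ℚ, a = 3 * s ^ 2 ∧ p = 6 * s ^ 3 ∧ r = 3 * c * s ∧
      ((s = 1 ∨ s = -1) ∧ (c = 1 ∨ c = -1) ∨ (s = 1 / 2 ∨ s = -1 / 2) ∧ c = 0) := by
  have e0 := h 0
  have e1 := h 1
  have e2 := h (-1)
  have e3 := h 2
  have e4 := h (-2)
  have e5 := h 3
  have e6 := h (-3)
  have k6 : p ^ 2 = 4 / 3 * a ^ 3 := by linarith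
  have k5 : p * q = 2 * a ^ 2 * b := by linarith
  have k4 : q ^ 2 + 2 * p * r = 4 * (a ^ 2 * c + a * b ^ 2) := by linarith
  have k3 : 2 * p * w + 2 * q * r = 4 / 3 * (6 * a * b * c + b ^ 3) := by linarith
  have k2 : r ^ 2 + 2 * q * w = 4 / 3 * (3 * a * c ^ 2 + 3 * b ^ 2 * c - a) + 1 := by linarith
  have k1 : 2 * r * w = 4 / 3 * (3 * b * c ^ 2 - b) := by linarith
  have k0 : w ^ 2 = 4 / 3 * (c ^ 3 - c) := by linarith
  clear e0 e1 e2 e3 e4 e5 e6 h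
  obtain ⟨s, hs⟩ : ∃ s, p = 2 * a * s := ⟨p / (2 * a), by field_simp⟩
  have has : a = 3 * s ^ 2 := by
    have : a ^ 2 * (a - 3 * s ^ 2) = 0 := by
      rw [hs] at k6
      linear_combination (-3 / 4) * k6
    have := (mul_eq_zero.mp this).resolve_left (pow_ne_zero 2 ha)
    linarith
  have hs0 : s ≠ 0 := by
    rintro rfl
    simp at hs
    exact hp hs
  subst has
  obtain rfl : p = 6 * s ^ 3 := by rw [hs]; ring
  clear hs hp ha k6
  obtain ⟨β, rfl⟩ : ∃ β, b = 6 * s * β := ⟨b / (6 * s), by field_simp⟩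
  obtain ⟨d, rfl⟩ : ∃ d, c = d + 3 * β ^ 2 := ⟨c - 3 * β ^ 2, by ring⟩
  have hs3 : s ^ 3 ≠ 0 := pow_ne_zero 3 hs0
  obtain rfl : q = 18 * s ^ 2 * β := mul_left_cancel₀ hs3 (by linear_combination k5 / 6)
  obtain rfl : r = 18 * s * β ^ 2 + 3 * d * s :=
    mul_left_cancel₀ hs3 (by linear_combination k4 / 12)
  obtain rfl : w = 6 * β ^ 3 + 3 * d * β :=
    mul_left_cancel₀ hs3 (by linear_combination k3 / 12)
  have m2 : (3 * d ^ 2 - 4) * s ^ 2 = -1 := by linear_combination -k2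
  have hd : 3 * d ^ 2 - 4 ≠ 0 := by
    intro h
    rw [h] at m2
    norm_num at m2
  obtain rfl : β = 0 := by
    have : (2 * s * (3 * d ^ 2 - 4)) * β = 0 := by linear_combination -k1
    exact (mul_eq_zero.mp this).resolve_left (by positivity)
  refine ⟨by ring, by ring, by ring, s, rfl, rfl, by ring, ?_⟩
  have m0 : d * ((d - 1) * (d + 1)) = 0 := by linear_combination (-3 / 4) * k0
  rcases mul_eq_zero.mp m0 with rfl | m0
  · right
    have : (s - 1 / 2) * (s + 1 / 2) = 0 := by linear_combination (-1 / 4) * m2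
    refine ⟨(mul_eq_zero.mp this).imp (fun h => ?_) (fun h => ?_), by ring⟩ <;> linarith
  · left
    have hd2 : d ^ 2 = 1 := by linear_combination m0
    have : (s - 1) * (s + 1) = 0 := by rw [hd2] at m2; linear_combination -m2
    refine ⟨(mul_eq_zero.mp this).imp (fun h => ?_) (fun h => ?_),
      (mul_eq_zero.mp m0).imp (fun h => ?_) (fun h => ?_)⟩ <;> linarith

theorem eval_polyBinom_two (f : ℚ[X]) (x : ℚ) :
    (polyBinom f 2).eval x = f.eval x * (f.eval x - 1) / 2 := by
  simp [polyBinom, Finset.prod_range_succ, Nat.factorial]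
  ring

theorem eval_polyBinom_three (f : ℚ[X]) (x : ℚ) :
    (polyBinom f 3).eval x = f.eval x * (f.eval x - 1) * (f.eval x - 2) / 6 := by
  simp [polyBinom, Finset.prod_range_succ, Nat.factorial]
  ring

theorem polyBinom_equation_iff_eval (f g : ℚ[X]) :
    polyBinom f 3 + polyBinom X 2 = polyBinom g 2 ↔
      ∀ t : ℚ, (2 * g.eval ((t + 1) / 2) - 1) ^ 2 =
        4 / 3 * ((f.eval ((t + 1) / 2) - 1) ^ 3 - (f.eval ((t + 1) / 2) - 1)) + t ^ 2 := by
  constructor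
  · intro h t
    have := congrArg (eval ((t + 1) / 2)) h
    simp only [eval_add, eval_polyBinom_two, eval_polyBinom_three, eval_X] at this
    linear_combination (-8) * this
  · intro h
    refine Polynomial.funext fun x => ?_
    have := h (2 * x - 1)
    rw [show (2 * x - 1 + 1) / 2 = x by ring] at this
    simp only [eval_add, eval_polyBinom_two, eval_polyBinom_three, eval_X]
    linear_combination (-1 / 8) * this

theorem comp_one_sub_X_eq_iff (f g : ℚ[X]) : f.comp (1 - X) = g ↔ f = g.comp (1 - X) := by
  constructor <;> rintro rfl <;> simp [comp_assoc]

theorem polynomial_solutions_k_eq_3 (f₁ f₂ : Polynomial ℚ)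
    (h₁ : f₁.natDegree = 2) (h₂ : f₂.natDegree = 3) :
    polyBinom f₁ 3 + polyBinom X 2 = polyBinom f₂ 2 ↔
      ((f₁ = 12 * X ^ 2 - 12 * X + 3 ∧ f₂ = -24 * X ^ 3 + 36 * X ^ 2 - 15 * X + 2) ∨
       (f₁.comp (1 - X) = 12 * X ^ 2 - 12 * X + 3 ∧
        f₂.comp (1 - X) = -24 * X ^ 3 + 36 * X ^ 2 - 15 * X + 2)) ∨
      ((f₁ = 12 * X ^ 2 - 12 * X + 5 ∧ f₂ = -24 * X ^ 3 + 36 * X ^ 2 - 21 * X + 5) ∨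
       (f₁.comp (1 - X) = 12 * X ^ 2 - 12 * X + 5 ∧
        f₂.comp (1 - X) = -24 * X ^ 3 + 36 * X ^ 2 - 21 * X + 5)) ∨
      ((f₁ = C (1/4 : ℚ) * (12 * X ^ 2 - 12 * X + 7) ∧
        f₂ = C (1/8 : ℚ) * (-24 * X ^ 3 + 36 * X ^ 2 - 18 * X + 7)) ∨
       (f₁.comp (1 - X) = C (1/4 : ℚ) * (12 * X ^ 2 - 12 * X + 7) ∧
        f₂.comp (1 - X) = C (1/8 : ℚ) * (-24 * X ^ 3 + 36 * X ^ 2 - 18 * X + 7))) := by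
  have hf₁ := f₁.as_sum_range_C_mul_X_pow
  have hf₂ := f₂.as_sum_range_C_mul_X_pow
  have ha : f₁.coeff 2 ≠ 0 := by
    rw [← h₁]
    exact leadingCoeff_ne_zero.mpr (by rintro rfl; simp at h₁)
  have hp : f₂.coeff 3 ≠ 0 := by
    rw [← h₂]
    exact leadingCoeff_ne_zero.mpr (by rintro rfl; simp at h₂)
  simp only [h₁, h₂, Finset.sum_range_succ, Finset.sum_range_zero] at hf₁ hf₂
  rw [polyBinom_equation_iff_eval]
  simp only [comp_one_sub_X_eq_iff]
  constructor
  · intro h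
    generalize f₁.coeff 0 = a₀, f₁.coeff 1 = a₁, f₁.coeff 2 = a₂ at hf₁ ha
    generalize f₂.coeff 0 = b₀, f₂.coeff 1 = b₁, f₂.coeff 2 = b₂, f₂.coeff 3 = b₃ at hf₂ hp
    subst hf₁ hf₂
    obtain ⟨c, hc⟩ : ∃ c, a₂ / 4 + a₁ / 2 + a₀ - 1 = c := ⟨_, rfl⟩
    obtain ⟨hb, hq, hw, s, ha, hp, hr, hs⟩ :=
      parametrization_coeffs (a := a₂ / 4) (b := a₂ / 2 + a₁ / 2)
        (c := c) (p := b₃ / 4) (q := 3 * b₃ / 4 + b₂ / 2)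
        (r := 3 * b₃ / 4 + b₂ + b₁) (w := b₃ / 4 + b₂ / 2 + b₁ + 2 * b₀ - 1)
        (by simpa using ha) (by simpa using hp) (fun t => by
          have := h t
          simp only [eval_add, eval_mul, eval_C, eval_pow, eval_X, eval_zero] at this
          rw [← hc]
          linear_combination this)
    have ha₂ : a₂ = 12 * s ^ 2 := by linear_combination 4 * ha
    have ha₁ : a₁ = -a₂ := by linear_combination 2 * hb
    have ha₀ : a₀ = c + 1 + a₂ / 4 := by linear_combination hc - ha₁ / 2
    have hb₃ : b₃ = 24 * s ^ 3 := by linear_combination 4 * hp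
    have hb₂ : b₂ = -3 * b₃ / 2 := by linear_combination 2 * hq
    have hb₁ : b₁ = 3 * c * s + 3 * b₃ / 4 := by linear_combination hr - hb₂
    have hb₀ : b₀ = 1 / 2 - b₃ / 8 - 3 * c * s / 2 := by
      linear_combination hw / 2 - hb₂ / 4 - hb₁ / 2
    subst ha₂ ha₁ ha₀ hb₃ hb₂ hb₁ hb₀
    clear h hb hq hw hr hp ha hc
    rcases hs with ⟨rfl | rfl, rfl | rfl⟩ | ⟨rfl | rfl, rfl⟩
    on_goal 1 => refine .inr (.inl (.inr ?_))
    on_goal 2 => refine .inl (.inr ?_)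
    on_goal 3 => refine .inr (.inl (.inl ?_))
    on_goal 4 => refine .inl (.inl ?_)
    on_goal 5 => refine .inr (.inr (.inr ?_))
    on_goal 6 => refine .inr (.inr (.inl ?_))
    all_goals
      constructor <;>
      · refine Polynomial.funext fun x => ?_
        simp
        ring
  · rintro ((⟨rfl, rfl⟩ | ⟨rfl, rfl⟩) | (⟨rfl, rfl⟩ | ⟨rfl, rfl⟩) | (⟨rfl, rfl⟩ | ⟨rfl, rfl⟩)) t <;>
    · simp
      ring
end

section
/- Let g₁ = (140X² − 140X + 41)/2 and g₂ = (5488000X⁷ − 19208000X⁶ + 28812000X⁵ − 24010000X⁴ + 11997160X³ − 3589740X² + 594370X − 41847)/96 in ℚ[X]. Then B(g₁,7) + B(X,2) = B(g₂,2) holds in ℚ[X], and for any polynomials f₁, f₂ ∈ ℚ[X] with deg f₁ = 2 and deg f₂ = 7 satisfying B(f₁,7) + B(X,2) = B(f₂,2), either (f₁(X), f₂(X)) = (g₁(X), g₂(X)) or (f₁(X), f₂(X)) = (g₁(1−X), g₂(1−X)). -/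
open Polynomial

noncomputable def g₁ : Polynomial ℚ := C (1/2 : ℚ) * (140 * X ^ 2 - 140 * X + 41)

noncomputable def g₂ : Polynomial ℚ :=
  C (1/96 : ℚ) * (5488000 * X ^ 7 - 19208000 * X ^ 6 + 28812000 * X ^ 5 -
    24010000 * X ^ 4 + 11997160 * X ^ 3 - 3589740 * X ^ 2 + 594370 * X - 41847)

theorem polyBinom_eval_seven (f : Polynomial ℚ) (x : ℚ) :
    (polyBinom f 7).eval x =
      (f.eval x - 3) * ((f.eval x - 3) ^ 2 - 1) * ((f.eval x - 3) ^ 2 - 4) *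
        ((f.eval x - 3) ^ 2 - 9) / 5040 := by
  simp [polyBinom, Finset.prod_range_succ, Nat.factorial]
  ring

theorem polyBinom_eval_two (f : Polynomial ℚ) (x : ℚ) :
    (polyBinom f 2).eval x = f.eval x * (f.eval x - 1) / 2 := by
  simp [polyBinom, Finset.prod_range_succ, Nat.factorial]
  ring

theorem coeff_eq_zero_of_sum_pow_eq_zero (n : ℕ) (a : ℕ → ℚ)
    (h : ∀ x : ℚ, ∑ i ∈ Finset.range n, a i * x ^ i = 0) : ∀ i < n, a i = 0 := by
  have hp : ∑ i ∈ Finset.range n, C (a i) * X ^ i = (0 : Polynomial ℚ) :=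
    Polynomial.funext fun x => by simpa [eval_finsetSum] using h x
  intro i hi
  have hc := congrArg (fun p => coeff p i) hp
  simpa [finsetSum_coeff, coeff_C_mul, coeff_X_pow, hi] using hc

/-- The solutions of the equation obtained by completing the square in the quadratic polynomial. -/
theorem eq_of_centered_identity {A c s : ℚ} {g : ℕ → ℚ} (hA : A ≠ 0) (hg : g 7 ≠ 0)
    (h : ∀ z : ℚ, (A * z ^ 2 + c) * ((A * z ^ 2 + c) ^ 2 - 1) * ((A * z ^ 2 + c) ^ 2 - 4) *
      ((A * z ^ 2 + c) ^ 2 - 9) + 630 * (2 * z + s) ^ 2 =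
      630 * (∑ i ∈ Finset.range 8, g i * z ^ i) ^ 2) :
    A = 70 ∧ c = 0 ∧ s = 0 ∧
      ((∀ z : ℚ, ∑ i ∈ Finset.range 8, g i * z ^ i = (343000 * z ^ 7 - 490 * z ^ 3) / 3) ∨
       (∀ z : ℚ, ∑ i ∈ Finset.range 8, g i * z ^ i = -((343000 * z ^ 7 - 490 * z ^ 3) / 3))) := by
  have hcoeff := coeff_eq_zero_of_sum_pow_eq_zero 15 (fun n =>
    630 * (∑ i ∈ Finset.range 8, if i ≤ n ∧ n - i < 8 then g i * g (n - i) else 0) -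
      (if n = 0 then c * (c ^ 2 - 1) * (c ^ 2 - 4) * (c ^ 2 - 9) + 630 * s ^ 2
       else if n = 1 then 2520 * s
       else if n = 2 then (7 * c ^ 6 - 70 * c ^ 4 + 147 * c ^ 2 - 36) * A + 2520
       else if n = 4 then (21 * c ^ 5 - 140 * c ^ 3 + 147 * c) * A ^ 2
       else if n = 6 then (35 * c ^ 4 - 140 * c ^ 2 + 49) * A ^ 3
       else if n = 8 then (35 * c ^ 3 - 70 * c) * A ^ 4
       else if n = 10 then (21 * c ^ 2 - 14) * A ^ 5
       else if n = 12 then 7 * c * A ^ 6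
       else if n = 14 then A ^ 7 else 0)) (by
    intro z
    have hz := h z
    simp [Finset.sum_range_succ] at hz ⊢
    linear_combination -hz)
  have e14 := hcoeff 14 (by norm_num)
  have e13 := hcoeff 13 (by norm_num)
  have e12 := hcoeff 12 (by norm_num)
  have e11 := hcoeff 11 (by norm_num)
  have e10 := hcoeff 10 (by norm_num)
  have e9 := hcoeff 9 (by norm_num)
  have e8 := hcoeff 8 (by norm_num)
  have e7 := hcoeff 7 (by norm_num)
  have e6 := hcoeff 6 (by norm_num)
  have e2 := hcoeff 2 (by norm_num)
  have e1 := hcoeff 1 (by norm_num)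
  have e0 := hcoeff 0 (by norm_num)
  clear hcoeff
  simp [Finset.sum_range_succ] at e14 e13 e12 e11 e10 e9 e8 e7 e6 e2 e1 e0
  have g6 : g 6 = 0 := mul_left_cancel₀ hg (by linear_combination e13 / 2)
  rw [g6] at e12 e11 e10 e9 e8 e7 e6
  have g4 : g 4 = 0 := mul_left_cancel₀ hg (by linear_combination e11 / 2)
  rw [g4] at e10 e9 e8 e7 e6
  have g2 : g 2 = 0 := mul_left_cancel₀ hg (by linear_combination e9 / 2)
  rw [g2] at e8 e7 e6 e2
  have g0 : g 0 = 0 := mul_left_cancel₀ hg (by linear_combination e7 / 2)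
  rw [g0] at e6 e2 e1 e0
  have hs : s = 0 := by linear_combination -e1 / 2520
  have h5 : A * g 5 = 7 / 2 * c * g 7 := mul_left_cancel₀ hg (by
    linear_combination A * e12 / 1260 - 7 * c * e14 / 1260)
  have h3 : A ^ 2 * g 3 = (35 / 8 * c ^ 2 - 7) * g 7 := mul_left_cancel₀ hg (by
    linear_combination A ^ 2 * e10 / 1260 - (21 * c ^ 2 - 14) * e14 / 1260
      - (A * g 5 + 7 / 2 * c * g 7) / 2 * h5)
  have h1 : A ^ 3 * g 1 = (35 / 16 * c ^ 3 - 21 / 2 * c) * g 7 := mul_left_cancel₀ hg (by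
    linear_combination A ^ 3 * e8 / 1260 - (35 * c ^ 3 - 70 * c) * e14 / 1260
      - A ^ 2 * g 3 * h5 - 7 / 2 * c * g 7 * h3)
  have hcc : c = 0 := by
    have hp : c * (c - 1) * (c + 1) * (c - 2) * (c + 2) * (c - 3) * (c + 3) = 0 := by
      rw [hs] at e0
      linear_combination -e0
    have hd : (2 * (7 / 2 * c) * (35 / 16 * c ^ 3 - 21 / 2 * c) + (35 / 8 * c ^ 2 - 7) ^ 2 -
        (35 * c ^ 4 - 140 * c ^ 2 + 49)) = 0 := by
      have hu : g 7 ^ 2 ≠ 0 := pow_ne_zero 2 hg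
      refine mul_left_cancel₀ hu ?_
      linear_combination A ^ 4 * e6 / 630 - (35 * c ^ 4 - 140 * c ^ 2 + 49) * e14 / 630
        - 2 * A ^ 3 * g 1 * h5 - 7 * c * g 7 * h1
        - (A ^ 2 * g 3 + (35 / 8 * c ^ 2 - 7) * g 7) * h3
    simp only [mul_eq_zero, sub_eq_zero, add_eq_zero_iff_eq_neg, or_assoc] at hp
    rcases hp with rfl | rfl | rfl | rfl | rfl | rfl | rfl <;> first | rfl | norm_num at hd
  subst hcc hs
  have g5 : g 5 = 0 := mul_left_cancel₀ hA (by linear_combination h5)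
  have g1 : g 1 = 0 := mul_left_cancel₀ (pow_ne_zero 3 hA) (by linear_combination h1)
  rw [g1] at e2
  have hA70 : A = 70 := by linear_combination e2 / 36
  subst hA70
  refine ⟨rfl, rfl, rfl, ?_⟩
  have hu : (g 7 - 343000 / 3) * (g 7 + 343000 / 3) = 0 := by linear_combination e14 / 630
  rcases mul_eq_zero.mp hu with hu | hu
  · left
    intro z
    simp [Finset.sum_range_succ, g0, g1, g2, g4, g5, g6]
    linear_combination z ^ 3 * h3 / 4900 + (z ^ 7 - z ^ 3 * 7 / 4900) * hu
  · right
    intro z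
    simp [Finset.sum_range_succ, g0, g1, g2, g4, g5, g6]
    linear_combination z ^ 3 * h3 / 4900 + (z ^ 7 - z ^ 3 * 7 / 4900) * hu

theorem polynomial_solutions_k_eq_7 :
    polyBinom g₁ 7 + polyBinom X 2 = polyBinom g₂ 2 ∧
    ∀ f₁ f₂ : Polynomial ℚ, f₁.natDegree = 2 → f₂.natDegree = 7 →
      polyBinom f₁ 7 + polyBinom X 2 = polyBinom f₂ 2 →
      (f₁ = g₁ ∧ f₂ = g₂) ∨
      (f₁ = g₁.comp (1 - X) ∧ f₂ = g₂.comp (1 - X)) := by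
  constructor
  · refine Polynomial.funext fun x => ?_
    rw [eval_add, polyBinom_eval_seven, polyBinom_eval_two, polyBinom_eval_two]
    simp [g₁, g₂]
    ring
  intro f₁ f₂ hf₁ hf₂ h
  obtain ⟨A, hAdef⟩ : ∃ A, A = f₁.coeff 2 := ⟨_, rfl⟩
  have hA : A ≠ 0 := by
    rw [hAdef, ← hf₁, coeff_natDegree, leadingCoeff_ne_zero]
    rintro rfl
    simp at hf₁
  have hq : ∀ x, f₁.eval x = A * x ^ 2 + f₁.coeff 1 * x + f₁.coeff 0 := fun x => by
    rw [eval_eq_sum_range, hf₁, hAdef]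
    simp [Finset.sum_range_succ]
    ring
  generalize f₁.coeff 1 = B at hq
  generalize f₁.coeff 0 = D at hq
  have hsub : ∀ z, f₁.eval (z - B / (2 * A)) - 3 = A * z ^ 2 + (D - B ^ 2 / (4 * A) - 3) := by
    intro z
    rw [hq]
    field_simp
    ring
  obtain ⟨q, hqdef⟩ : ∃ q : Polynomial ℚ,
      q = (C 2 * f₂ - C 1).comp (X - C (B / (2 * A))) := ⟨_, rfl⟩
  have hqdeg : q.natDegree = 7 := by
    rw [hqdef, natDegree_comp, natDegree_X_sub_C, mul_one, natDegree_sub_C,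
      natDegree_C_mul two_ne_zero, hf₂]
  have hq7 : q.coeff 7 ≠ 0 := by
    rw [← hqdeg, coeff_natDegree, leadingCoeff_ne_zero]
    rintro rfl
    simp at hqdeg
  have hqeval : ∀ z, ∑ i ∈ Finset.range 8, q.coeff i * z ^ i =
      2 * f₂.eval (z - B / (2 * A)) - 1 := by
    intro z
    have hz := eval_eq_sum_range (p := q) z
    rw [hqdeg] at hz
    rw [← hz, hqdef]
    simp
  obtain ⟨rA, rc, rs, hsol⟩ := eq_of_centered_identity
    (c := D - B ^ 2 / (4 * A) - 3) (s := -(B / A) - 1) hA hq7 (fun z => by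
    have hz := congrArg (eval (z - B / (2 * A))) h
    rw [eval_add, polyBinom_eval_seven, polyBinom_eval_two, polyBinom_eval_two, hsub, eval_X] at hz
    rw [hqeval, show 2 * z + (-(B / A) - 1) = 2 * (z - B / (2 * A)) - 1 by field_simp; ring]
    linear_combination 5040 * hz)
  subst rA
  have hB : B = -70 := by linarith
  subst hB
  have hD : D = 41 / 2 := by linarith
  subst hD
  have hf₁g (x : ℚ) : f₁.eval x = 70 * x ^ 2 - 70 * x + 41 / 2 := by rw [hq]; ring
  rcases hsol with hsol | hsol
  · left
    constructor <;> refine Polynomial.funext fun x => ?_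
    · rw [hf₁g]
      simp [g₁]
      ring
    · have hx := hsol (x - 1 / 2)
      rw [hqeval, show x - 1 / 2 - -70 / (2 * 70) = x by ring] at hx
      simp [g₂]
      linear_combination hx / 2
  · right
    constructor <;> refine Polynomial.funext fun x => ?_
    · rw [hf₁g]
      simp [g₁]
      ring
    · have hx := hsol (x - 1 / 2)
      rw [hqeval, show x - 1 / 2 - -70 / (2 * 70) = x by ring] at hx
      simp [g₂]
      linear_combination hx / 2
end

section
/- Let k ∈ {9, 11, 13, 15, 17, 19}. Then there are no polynomials f₁, f₂ ∈ ℚ[X] with deg f₁ = 2 and deg f₂ = k satisfying the polynomial identity B(f₁,k) + B(X,2) = B(f₂,2) in ℚ[X]. -/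
open Polynomial

/-- If `g² = λ q² + w` over a field of characteristic zero and `deg w < deg g = deg q`,
then `w = 0`. -/
theorem Polynomial.eq_zero_of_sq_eq_C_mul_sq_add {K : Type*} [Field K] [CharZero K]
    {g q w : K[X]} {l : K} {n : ℕ} (hg : g.natDegree = n) (hq : q.natDegree = n)
    (hw : w.natDegree < n) (h : g ^ 2 = C l * q ^ 2 + w) : w = 0 := by
  have hg0 : g.coeff n ≠ 0 := by
    rw [← hg]
    exact leadingCoeff_ne_zero.2 fun h0 => by simp [h0] at hg; omega
  have hq0 : q.coeff n ≠ 0 := by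
    rw [← hq]
    exact leadingCoeff_ne_zero.2 fun h0 => by simp [h0] at hq; omega
  have hl : g.coeff n ^ 2 = l * q.coeff n ^ 2 := by
    have := congrArg (fun p => p.coeff (2 * n)) h
    simpa [coeff_pow_of_natDegree_le hg.le, coeff_pow_of_natDegree_le hq.le,
      coeff_eq_zero_of_natDegree_lt (show w.natDegree < 2 * n by omega)] using this
  set r := g.coeff n / q.coeff n with hr
  have hrl : r ^ 2 = l := by rw [hr, div_pow, hl]; field_simp
  have hfac : (g - C r * q) * (g + C r * q) = w := by
    rw [← hrl, C_pow] at h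
    linear_combination h
  have hcoeff : (g + C r * q).coeff n ≠ 0 := by
    rw [coeff_add, coeff_C_mul, hr, div_mul_cancel₀ _ hq0, ← two_mul]
    exact mul_ne_zero two_ne_zero hg0
  by_contra hw0
  rw [← hfac] at hw0
  have := natDegree_mul (left_ne_zero_of_mul hw0) (right_ne_zero_of_mul hw0)
  rw [hfac] at this
  have := le_natDegree_of_ne_zero hcoeff
  omega

/-- For every `e`, write `P = (X - e) H² + R` with `deg H = m` and `deg R ≤ m`. If `deg R ≥ 2`
whenever `e` is a root of `P`, then `g² = c P(t) + (2X - 1)²` has no solutions with `deg t = 2`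
and `deg g = 2m + 1`. -/
theorem Polynomial.sq_ne_C_mul_comp_add_sq {m : ℕ} (hm : 1 ≤ m) {P : ℚ[X]} {c : ℚ} (hc : c ≠ 0)
    (hP : ∀ e : ℚ, ∃ H R : ℚ[X], H.natDegree = m ∧ R.natDegree ≤ m ∧
      P = (X - C e) * H ^ 2 + R ∧ (P.eval e = 0 → 2 ≤ R.natDegree))
    {t g : ℚ[X]} (ht : t.natDegree = 2) (hg : g.natDegree = 2 * m + 1) :
    g ^ 2 ≠ C c * P.comp t + (2 * X - 1) ^ 2 := by
  intro h
  obtain ⟨a, b, e, ha, hsq⟩ :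
      ∃ a b e : ℚ, a ≠ 0 ∧ t = C a * (X + C b) ^ 2 + C e := by
    have ha : t.coeff 2 ≠ 0 := by
      rw [← ht]
      exact leadingCoeff_ne_zero.2 fun h0 => by simp [h0] at ht
    refine ⟨t.coeff 2, t.coeff 1 / (2 * t.coeff 2),
      t.coeff 0 - t.coeff 1 ^ 2 / (4 * t.coeff 2), ha, ?_⟩
    refine Polynomial.funext fun x => ?_
    have h2 : t.eval x = t.coeff 0 + t.coeff 1 * x + t.coeff 2 * x ^ 2 := by
      rw [eval_eq_sum_range, ht]
      simp [Finset.sum_range_succ]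
    simp only [eval_add, eval_mul, eval_C, eval_pow, eval_X]
    rw [h2]
    field_simp
    ring
  obtain ⟨H, R, hH, hR, hPHR, hroot⟩ := hP e
  have hw : C c * R.comp t + (2 * X - 1) ^ 2 = 0 := by
    refine eq_zero_of_sq_eq_C_mul_sq_add (q := (X + C b) * H.comp t) (l := c * a) hg ?_ ?_ ?_
    · have hX : (X + C b : ℚ[X]) ≠ 0 := X_add_C_ne_zero b
      have hHt : (H.comp t).natDegree = 2 * m := by rw [natDegree_comp, hH, ht, mul_comm]
      rw [natDegree_mul hX (fun h0 => by simp [h0] at hHt; omega), hHt, natDegree_X_add_C,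
        add_comm]
    · have h1 : (C c * R.comp t).natDegree ≤ 2 * m := by
        refine (natDegree_C_mul_le _ _).trans ?_
        rw [natDegree_comp, ht]
        omega
      have h2 : ((2 * X - 1) ^ 2 : ℚ[X]).natDegree ≤ 2 := by compute_degree
      have := natDegree_add_le_of_degree_le h1 (h2.trans (show 2 ≤ 2 * m by omega))
      omega
    · have hcomp : P.comp t = (t - C e) * H.comp t ^ 2 + R.comp t := by
        rw [hPHR]; simp
      rw [h, hcomp, C_mul]
      linear_combination (C c * H.comp t ^ 2) * hsq
  have heval (x : ℚ) : c * R.eval (a * (x + b) ^ 2 + e) + (2 * x - 1) ^ 2 = 0 := by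
    have := congrArg (eval x) hw
    simpa [hsq, eval_comp] using this
  have hb : b = -1 / 2 := by
    have h1 := heval (1 / 2)
    have h2 := heval (-2 * b - 1 / 2)
    rw [show -2 * b - 1 / 2 + b = -(1 / 2 + b) by ring, neg_sq] at h2
    have h3 : (2 * b + 1) ^ 2 = 0 := by linear_combination (h2 - h1) / 4
    linarith [pow_eq_zero_iff two_ne_zero |>.1 h3]
  have hRe : R.eval e = 0 := by
    have := heval (1 / 2)
    rw [hb] at this
    norm_num at this
    exact this.resolve_left hc
  have hdeg : 2 ≤ R.natDegree := hroot (by rw [hPHR]; simp [hRe])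
  have h1 : (R.comp t).natDegree ≤ 2 := by
    have h2 : R.comp t = C (-c⁻¹) * (2 * X - 1) ^ 2 := by
      have hcc : C c⁻¹ * C c = (1 : ℚ[X]) := by rw [← C_mul, inv_mul_cancel₀ hc, C_1]
      rw [C_neg]
      linear_combination C c⁻¹ * hw - R.comp t * hcc
    rw [h2]
    compute_degree
  rw [natDegree_comp, ht] at h1
  omega

/-- The product `∏ (X - (i - m))` over `0 ≤ i ≤ 2m`. -/
noncomputable def centeredProd (m : ℕ) : ℚ[X] :=
  ∏ i ∈ Finset.range (2 * m + 1), (X - C ((i : ℚ) - m))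

theorem eval_centeredProd (m : ℕ) (x : ℚ) :
    (centeredProd m).eval x = ∏ i ∈ Finset.range (2 * m + 1), (x - ((i : ℚ) - m)) := by
  simp [centeredProd, eval_prod]

theorem exists_of_eval_centeredProd_eq_zero {m : ℕ} {e : ℚ} (h : (centeredProd m).eval e = 0) :
    ∃ i < 2 * m + 1, e = (i : ℚ) - m := by
  rw [eval_centeredProd, Finset.prod_eq_zero_iff] at h
  obtain ⟨i, hi, h⟩ := h
  exact ⟨i, Finset.mem_range.1 hi, by linarith⟩

theorem polyBinom_two_mul_add_one (f : ℚ[X]) (m : ℕ) :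
    polyBinom f (2 * m + 1) =
      C (((2 * m + 1).factorial : ℚ)⁻¹) * (centeredProd m).comp (f - C (m : ℚ)) := by
  rw [polyBinom, centeredProd, prod_comp]
  congr 1
  refine Finset.prod_congr rfl fun i _ => ?_
  simp

theorem eight_mul_polyBinom_two_add_one (f : ℚ[X]) :
    8 * polyBinom f 2 + 1 = (2 * f - 1) ^ 2 := by
  have h2 : C ((Nat.factorial 2 : ℚ)⁻¹) * 2 = (1 : ℚ[X]) := by
    rw [show (2 : ℚ[X]) = C 2 from rfl, ← C_mul]
    norm_num [Nat.factorial]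
  simp only [polyBinom, Finset.prod_range_succ, Finset.prod_range_zero, Nat.cast_zero,
    Nat.cast_one]
  linear_combination (4 * f * (f - 1)) * h2

theorem polyBinom_add_polyBinom_X_ne {m : ℕ} (hm : 1 ≤ m)
    (hP : ∀ e : ℚ, ∃ H R : ℚ[X], H.natDegree = m ∧ R.natDegree ≤ m ∧
      centeredProd m = (X - C e) * H ^ 2 + R ∧
        ((centeredProd m).eval e = 0 → 2 ≤ R.natDegree))
    {f₁ f₂ : ℚ[X]} (h₁ : f₁.natDegree = 2) (h₂ : f₂.natDegree = 2 * m + 1) :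
    polyBinom f₁ (2 * m + 1) + polyBinom X 2 ≠ polyBinom f₂ 2 := by
  intro h
  have hc : (8 * ((2 * m + 1).factorial : ℚ)⁻¹) ≠ 0 := by positivity
  refine sq_ne_C_mul_comp_add_sq hm hc hP (t := f₁ - C (m : ℚ)) (g := 2 * f₂ - 1) ?_ ?_ ?_
  · rw [natDegree_sub_C, h₁]
  · rw [← C_1, natDegree_sub_C, show (2 : ℚ[X]) = C 2 from rfl, natDegree_C_mul two_ne_zero, h₂]
  · rw [← eight_mul_polyBinom_two_add_one, ← eight_mul_polyBinom_two_add_one, ← h,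
      polyBinom_two_mul_add_one, C_mul, show C (8 : ℚ) = (8 : ℚ[X]) from rfl]
    ring

set_option maxHeartbeats 4000000 in
theorem exists_centeredProd_four_eq (e : ℚ) : ∃ H R : ℚ[X], H.natDegree = 4 ∧ R.natDegree ≤ 4 ∧
    centeredProd 4 = (X - C e) * H ^ 2 + R ∧
      ((centeredProd 4).eval e = 0 → 2 ≤ R.natDegree) := by
  refine
    ⟨X ^ 4 +
      C (e / 2) * X ^ 3 +
      C ((3 * e ^ 2 - 120) / 8) * X ^ 2 +
      C ((5 * e ^ 3 - 120 * e) / 16) * X +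
      C ((35 * e ^ 4 - 720 * e ^ 2 + 3072) / 128),
      C ((63 * e ^ 5 - 1200 * e ^ 3 + 3072 * e) / 128) * X ^ 4 +
      C ((105 * e ^ 6 - 1800 * e ^ 4 + 3072 * e ^ 2 - 51200) / 512) * X ^ 3 +
      C ((135 * e ^ 7 - 9720 * e ^ 5 + 147072 * e ^ 3 - 368640 * e) / 1024) * X ^ 2 +
      C ((1575 * e ^ 8 - 74400 * e ^ 6 + 894720 * e ^ 4 - 1474560 * e ^ 2) / 16384) * X +
      C ((1225 * e ^ 9 - 50400 * e ^ 7 + 733440 * e ^ 5 - 4423680 * e ^ 3 + 9437184 * e) / 16384),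
      ?_, ?_, ?_, ?_⟩
  · compute_degree!
  · compute_degree
  · refine Polynomial.funext fun x => ?_
    rw [eval_centeredProd]
    simp only [Finset.prod_range_succ, Finset.prod_range_zero, eval_add, eval_mul, eval_sub,
      eval_pow, eval_C, eval_X, Nat.reduceMul, Nat.reduceAdd]
    push_cast
    ring
  · intro he
    obtain ⟨i, hi, rfl⟩ := exists_of_eval_centeredProd_eq_zero he
    clear he
    by_cases h0 : (i : ℚ) - (4 : ℕ) = 0 ∨ (i : ℚ) - (4 : ℕ) = 4 ∨ (i : ℚ) - (4 : ℕ) = -4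
    · refine le_trans (by norm_num) (le_natDegree_of_ne_zero (n := 3) ?_)
      simp only [coeff_add, coeff_C_mul, coeff_X_pow, coeff_X, coeff_C]
      rcases h0 with h0 | h0 | h0 <;> rw [h0] <;> norm_num
    · refine le_trans (by norm_num) (le_natDegree_of_ne_zero (n := 4) ?_)
      simp only [coeff_add, coeff_C_mul, coeff_X_pow, coeff_X, coeff_C]
      interval_cases i <;> norm_num at h0 <;> norm_num

set_option maxHeartbeats 4000000 in
theorem exists_centeredProd_five_eq (e : ℚ) : ∃ H R : ℚ[X], H.natDegree = 5 ∧ R.natDegree ≤ 5 ∧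
    centeredProd 5 = (X - C e) * H ^ 2 + R ∧
      ((centeredProd 5).eval e = 0 → 2 ≤ R.natDegree) := by
  refine
    ⟨X ^ 5 +
      C (e / 2) * X ^ 4 +
      C ((3 * e ^ 2 - 220) / 8) * X ^ 3 +
      C ((5 * e ^ 3 - 220 * e) / 16) * X ^ 2 +
      C ((35 * e ^ 4 - 1320 * e ^ 2 + 17072) / 128) * X +
      C ((63 * e ^ 5 - 2200 * e ^ 3 + 17072 * e) / 256),
      C ((231 * e ^ 6 - 7700 * e ^ 4 + 51216 * e ^ 2 - 158400) / 512) * X ^ 5 +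
      C ((99 * e ^ 7 - 3080 * e ^ 5 + 17072 * e ^ 3) / 512) * X ^ 4 +
      C ((2079 * e ^ 8 - 264880 * e ^ 6 + 7083296 * e ^ 4 - 45070080 * e ^ 2 + 53856000) / 16384) * X ^ 3 +
      C ((385 * e ^ 9 - 32780 * e ^ 7 + 728816 * e ^ 5 - 3755840 * e ^ 3) / 4096) * X ^ 2 +
      C ((4851 * e ^ 10 - 363440 * e ^ 8 + 11317152 * e ^ 6 - 165256960 * e ^ 4 + 874359552 * e ^ 2 - 943718400) / 65536) * X +
      C ((3969 * e ^ 11 - 277200 * e ^ 9 + 6991072 * e ^ 7 - 75116800 * e ^ 5 + 291453184 * e ^ 3) / 65536),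
      ?_, ?_, ?_, ?_⟩
  · compute_degree!
  · compute_degree
  · refine Polynomial.funext fun x => ?_
    rw [eval_centeredProd]
    simp only [Finset.prod_range_succ, Finset.prod_range_zero, eval_add, eval_mul, eval_sub,
      eval_pow, eval_C, eval_X, Nat.reduceMul, Nat.reduceAdd]
    push_cast
    ring
  · intro he
    obtain ⟨i, hi, rfl⟩ := exists_of_eval_centeredProd_eq_zero he
    clear he
    refine le_trans (by norm_num) (le_natDegree_of_ne_zero (n := 5) ?_)
    simp only [coeff_add, coeff_C_mul, coeff_X_pow, coeff_X, coeff_C]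
    interval_cases i <;> norm_num

set_option maxHeartbeats 4000000 in
theorem exists_centeredProd_six_eq (e : ℚ) : ∃ H R : ℚ[X], H.natDegree = 6 ∧ R.natDegree ≤ 6 ∧
    centeredProd 6 = (X - C e) * H ^ 2 + R ∧
      ((centeredProd 6).eval e = 0 → 2 ≤ R.natDegree) := by
  refine
    ⟨X ^ 6 +
      C (e / 2) * X ^ 5 +
      C ((3 * e ^ 2 - 364) / 8) * X ^ 4 +
      C ((5 * e ^ 3 - 364 * e) / 16) * X ^ 3 +
      C ((35 * e ^ 4 - 2184 * e ^ 2 + 59696) / 128) * X ^ 2 +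
      C ((63 * e ^ 5 - 3640 * e ^ 3 + 59696 * e) / 256) * X +
      C ((231 * e ^ 6 - 12740 * e ^ 4 + 179088 * e ^ 2 - 1040832) / 1024),
      C ((429 * e ^ 7 - 22932 * e ^ 5 + 298480 * e ^ 3 - 1040832 * e) / 1024) * X ^ 6 +
      C ((3003 * e ^ 8 - 152880 * e ^ 6 + 1790880 * e ^ 4 - 4163328 * e ^ 2 - 224550144) / 16384) * X ^ 5 +
      C ((1001 * e ^ 9 - 205296 * e ^ 7 + 8884512 * e ^ 5 - 109687552 * e ^ 3 + 378862848 * e) / 8192) * X ^ 4 +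
      C ((3003 * e ^ 10 - 416598 * e ^ 8 + 15404480 * e ^ 6 - 165572160 * e ^ 4 + 378862848 * e ^ 2 + 5732633088) / 32768) * X ^ 3 +
      C ((9555 * e ^ 11 - 1174628 * e ^ 9 + 65860704 * e ^ 7 - 1767362688 * e ^ 5 + 18575787776 * e ^ 3 - 62133507072 * e) / 131072) * X ^ 2 +
      C ((63063 * e ^ 12 - 7261800 * e ^ 10 + 326521104 * e ^ 8 - 6779811584 * e ^ 6 + 57242814720 * e ^ 4 - 124267014144 * e ^ 2 - 539749453824) / 1048576) * X +
      C ((53361 * e ^ 13 - 5885880 * e ^ 11 + 245046256 * e ^ 9 - 5044026624 * e ^ 7 + 58592911104 * e ^ 5 - 372801042432 * e ^ 3 + 1083331252224 * e) / 1048576),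
      ?_, ?_, ?_, ?_⟩
  · compute_degree!
  · compute_degree
  · refine Polynomial.funext fun x => ?_
    rw [eval_centeredProd]
    simp only [Finset.prod_range_succ, Finset.prod_range_zero, eval_add, eval_mul, eval_sub,
      eval_pow, eval_C, eval_X, Nat.reduceMul, Nat.reduceAdd]
    push_cast
    ring
  · intro he
    obtain ⟨i, hi, rfl⟩ := exists_of_eval_centeredProd_eq_zero he
    clear he
    by_cases h0 : (i : ℚ) - (6 : ℕ) = 0 ∨ (i : ℚ) - (6 : ℕ) = 6 ∨ (i : ℚ) - (6 : ℕ) = -6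
    · refine le_trans (by norm_num) (le_natDegree_of_ne_zero (n := 5) ?_)
      simp only [coeff_add, coeff_C_mul, coeff_X_pow, coeff_X, coeff_C]
      rcases h0 with h0 | h0 | h0 <;> rw [h0] <;> norm_num
    · refine le_trans (by norm_num) (le_natDegree_of_ne_zero (n := 6) ?_)
      simp only [coeff_add, coeff_C_mul, coeff_X_pow, coeff_X, coeff_C]
      interval_cases i <;> norm_num at h0 <;> norm_num

set_option maxHeartbeats 4000000 in
theorem exists_centeredProd_seven_eq (e : ℚ) : ∃ H R : ℚ[X], H.natDegree = 7 ∧ R.natDegree ≤ 7 ∧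
    centeredProd 7 = (X - C e) * H ^ 2 + R ∧
      ((centeredProd 7).eval e = 0 → 2 ≤ R.natDegree) := by
  refine
    ⟨X ^ 7 +
      C (e / 2) * X ^ 6 +
      C ((3 * e ^ 2 - 560) / 8) * X ^ 5 +
      C ((5 * e ^ 3 - 560 * e) / 16) * X ^ 4 +
      C ((35 * e ^ 4 - 3360 * e ^ 2 + 163968) / 128) * X ^ 3 +
      C ((63 * e ^ 5 - 5600 * e ^ 3 + 163968 * e) / 256) * X ^ 2 +
      C ((231 * e ^ 6 - 19600 * e ^ 4 + 491904 * e ^ 2 - 6287360) / 1024) * X +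
      C ((429 * e ^ 7 - 35280 * e ^ 5 + 819840 * e ^ 3 - 6287360 * e) / 2048),
      C ((6435 * e ^ 8 - 517440 * e ^ 6 + 11477760 * e ^ 4 - 75448320 * e ^ 2 - 411041792) / 16384) * X ^ 7 +
      C ((715 * e ^ 9 - 55440 * e ^ 7 + 1147776 * e ^ 5 - 6287360 * e ^ 3) / 4096) * X ^ 6 +
      C ((3861 * e ^ 10 - 1191960 * e ^ 8 + 78180480 * e ^ 6 - 1635179520 * e ^ 4 + 10562764800 * e ^ 2 + 14386462720) / 32768) * X ^ 5 +
      C ((2925 * e ^ 11 - 616000 * e ^ 9 + 35145600 * e ^ 7 - 661616640 * e ^ 5 + 3520921600 * e ^ 3) / 32768) * X ^ 4 +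
      C ((75075 * e ^ 12 - 14081760 * e ^ 10 + 1279971840 * e ^ 8 - 55717007360 * e ^ 6 + 1004369264640 * e ^ 4 - 6185555066880 * e ^ 2 + 736586891264) / 1048576) * X ^ 3 +
      C ((31185 * e ^ 13 - 5498640 * e ^ 11 + 398881280 * e ^ 9 - 13851248640 * e ^ 7 + 209324064768 * e ^ 5 - 1030925844480 * e ^ 3) / 524288) * X ^ 2 +
      C ((212355 * e ^ 14 - 35962080 * e ^ 12 + 2419490304 * e ^ 10 - 87049113600 * e ^ 8 + 1877557821440 * e ^ 6 - 22680368578560 * e ^ 4 + 118592687308800 * e ^ 2 - 106542032486400) / 4194304) * X +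
      C ((184041 * e ^ 15 - 30270240 * e ^ 13 + 1948101120 * e ^ 11 - 63242465280 * e ^ 9 + 1115773747200 * e ^ 7 - 10309258444800 * e ^ 5 + 39530895769600 * e ^ 3) / 4194304),
      ?_, ?_, ?_, ?_⟩
  · compute_degree!
  · compute_degree
  · refine Polynomial.funext fun x => ?_
    rw [eval_centeredProd]
    simp only [Finset.prod_range_succ, Finset.prod_range_zero, eval_add, eval_mul, eval_sub,
      eval_pow, eval_C, eval_X, Nat.reduceMul, Nat.reduceAdd]
    push_cast
    ring
  · intro he
    obtain ⟨i, hi, rfl⟩ := exists_of_eval_centeredProd_eq_zero he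
    clear he
    refine le_trans (by norm_num) (le_natDegree_of_ne_zero (n := 7) ?_)
    simp only [coeff_add, coeff_C_mul, coeff_X_pow, coeff_X, coeff_C]
    interval_cases i <;> norm_num

set_option maxHeartbeats 4000000 in
theorem exists_centeredProd_eight_eq (e : ℚ) : ∃ H R : ℚ[X], H.natDegree = 8 ∧ R.natDegree ≤ 8 ∧
    centeredProd 8 = (X - C e) * H ^ 2 + R ∧
      ((centeredProd 8).eval e = 0 → 2 ≤ R.natDegree) := by
  refine
    ⟨X ^ 8 +
      C (e / 2) * X ^ 7 +
      C ((3 * e ^ 2 - 816) / 8) * X ^ 6 +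
      C ((5 * e ^ 3 - 816 * e) / 16) * X ^ 5 +
      C ((35 * e ^ 4 - 4896 * e ^ 2 + 385152) / 128) * X ^ 4 +
      C ((63 * e ^ 5 - 8160 * e ^ 3 + 385152 * e) / 256) * X ^ 3 +
      C ((231 * e ^ 6 - 28560 * e ^ 4 + 1155456 * e ^ 2 - 28340224) / 1024) * X ^ 2 +
      C ((429 * e ^ 7 - 51408 * e ^ 5 + 1925760 * e ^ 3 - 28340224 * e) / 2048) * X +
      C ((6435 * e ^ 8 - 753984 * e ^ 6 + 26960640 * e ^ 4 - 340082688 * e ^ 2 + 641728512) / 32768),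
      C ((12155 * e ^ 9 - 1400256 * e ^ 7 + 48529152 * e ^ 5 - 566804480 * e ^ 3 + 641728512 * e) / 32768) * X ^ 8 +
      C ((21879 * e ^ 10 - 2450448 * e ^ 8 + 80881920 * e ^ 6 - 850206720 * e ^ 4 + 641728512 * e ^ 2 - 415840075776) / 131072) * X ^ 7 +
      C ((29835 * e ^ 11 - 13185744 * e ^ 9 + 1246599936 * e ^ 7 - 40620036096 * e ^ 5 + 463154184192 * e ^ 3 - 523650465792 * e) / 262144) * X ^ 6 +
      C ((182325 * e ^ 12 - 55310112 * e ^ 10 + 4605745536 * e ^ 8 - 137667338240 * e ^ 6 + 1390746009600 * e ^ 4 - 1047300931584 * e ^ 2 + 279444530921472) / 2097152) * X ^ 5 +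
      C ((294525 * e ^ 13 - 79878240 * e ^ 11 + 10957319808 * e ^ 9 - 717526843392 * e ^ 7 + 20360636891136 * e ^ 5 - 219353180012544 * e ^ 3 + 247163019853824 * e) / 4194304) * X ^ 4 +
      C ((984555 * e ^ 14 - 251696016 * e ^ 12 + 27480601728 * e ^ 10 - 1465573810176 * e ^ 8 + 35790434107392 * e ^ 6 - 330077070950400 * e ^ 4 + 247163019853824 * e ^ 2 - 23473340597403648) / 16777216) * X ^ 3 +
      C ((1684683 * e ^ 15 - 414502704 * e ^ 13 + 42035587200 * e ^ 11 - 2416508510208 * e ^ 9 + 86694789611520 * e ^ 7 - 1771943173816320 * e ^ 5 + 16310528947257344 * e ^ 3 - 18186729777266688 * e) / 33554432) * X ^ 2 +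
      C ((46930455 * e ^ 16 - 11232853632 * e ^ 14 + 1091538759168 * e ^ 12 - 56287341379584 * e ^ 10 + 1665505270628352 * e ^ 8 - 27157902284292096 * e ^ 6 + 197703651525918720 * e ^ 4 - 145493838218133504 * e ^ 2 + 1333769177143443456) / 1073741824) * X +
      C ((41409225 * e ^ 17 - 9703774080 * e ^ 15 + 915475309056 * e ^ 13 - 45032646574080 * e ^ 11 + 1247968966017024 * e ^ 9 - 19305399903584256 * e ^ 7 + 150259057456840704 * e ^ 5 - 436481514654400512 * e ^ 3 + 411815483113734144 * e) / 1073741824),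
      ?_, ?_, ?_, ?_⟩
  · compute_degree!
  · compute_degree
  · refine Polynomial.funext fun x => ?_
    rw [eval_centeredProd]
    simp only [Finset.prod_range_succ, Finset.prod_range_zero, eval_add, eval_mul, eval_sub,
      eval_pow, eval_C, eval_X, Nat.reduceMul, Nat.reduceAdd]
    push_cast
    ring
  · intro he
    obtain ⟨i, hi, rfl⟩ := exists_of_eval_centeredProd_eq_zero he
    clear he
    by_cases h0 : (i : ℚ) - (8 : ℕ) = 0 ∨ (i : ℚ) - (8 : ℕ) = 8 ∨ (i : ℚ) - (8 : ℕ) = -8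
    · refine le_trans (by norm_num) (le_natDegree_of_ne_zero (n := 7) ?_)
      simp only [coeff_add, coeff_C_mul, coeff_X_pow, coeff_X, coeff_C]
      rcases h0 with h0 | h0 | h0 <;> rw [h0] <;> norm_num
    · refine le_trans (by norm_num) (le_natDegree_of_ne_zero (n := 8) ?_)
      simp only [coeff_add, coeff_C_mul, coeff_X_pow, coeff_X, coeff_C]
      interval_cases i <;> norm_num at h0 <;> norm_num

set_option maxHeartbeats 4000000 in
theorem exists_centeredProd_nine_eq (e : ℚ) : ∃ H R : ℚ[X], H.natDegree = 9 ∧ R.natDegree ≤ 9 ∧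
    centeredProd 9 = (X - C e) * H ^ 2 + R ∧
      ((centeredProd 9).eval e = 0 → 2 ≤ R.natDegree) := by
  refine
    ⟨X ^ 9 +
      C (e / 2) * X ^ 8 +
      C ((3 * e ^ 2 - 1140) / 8) * X ^ 7 +
      C ((5 * e ^ 3 - 1140 * e) / 16) * X ^ 6 +
      C ((35 * e ^ 4 - 6840 * e ^ 2 + 808944) / 128) * X ^ 5 +
      C ((63 * e ^ 5 - 11400 * e ^ 3 + 808944 * e) / 256) * X ^ 4 +
      C ((231 * e ^ 6 - 39900 * e ^ 4 + 2426832 * e ^ 2 - 101481280) / 1024) * X ^ 3 +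
      C ((429 * e ^ 7 - 71820 * e ^ 5 + 4044720 * e ^ 3 - 101481280 * e) / 2048) * X ^ 2 +
      C ((6435 * e ^ 8 - 1053360 * e ^ 6 + 56626080 * e ^ 4 - 1217775360 * e ^ 2 + 12423322368) / 32768) * X +
      C ((12155 * e ^ 9 - 1956240 * e ^ 7 + 101926944 * e ^ 5 - 2029625600 * e ^ 3 + 12423322368 * e) / 65536),
      C ((46189 * e ^ 10 - 7335900 * e ^ 8 + 373732128 * e ^ 6 - 7103689600 * e ^ 4 + 37269967104 * e ^ 2 - 905257036800) / 131072) * X ^ 9 +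
      C ((20995 * e ^ 11 - 3260400 * e ^ 9 + 160170912 * e ^ 7 - 2841475840 * e ^ 5 + 12423322368 * e ^ 3) / 131072) * X ^ 8 +
      C ((230945 * e ^ 12 - 140523240 * e ^ 10 + 18407646576 * e ^ 8 - 880524010240 * e ^ 6 + 16308222189312 * e ^ 4 - 84975524997120 * e ^ 2 + 996293343744000) / 2097152) * X ^ 7 +
      C ((88825 * e ^ 13 - 37272300 * e ^ 11 + 4339742880 * e ^ 9 - 192742967680 * e ^ 7 + 3276552424704 * e ^ 5 - 14162587499520 * e ^ 3) / 1048576) * X ^ 6 +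
      C ((1154725 * e ^ 14 - 434448300 * e ^ 12 + 85354733904 * e ^ 10 - 7975892674240 * e ^ 8 + 335156003411712 * e ^ 6 - 5873950367278080 * e ^ 4 + 30149316268978176 * e ^ 2 - 163073219615539200) / 16777216) * X ^ 5 +
      C ((969969 * e ^ 15 - 344724600 * e ^ 13 + 53815816752 * e ^ 11 - 4157114758400 * e ^ 9 + 153042459780864 * e ^ 7 - 2383570356910080 * e ^ 5 + 10049772089659392 * e ^ 3) / 16777216) * X ^ 4 +
      C ((53348295 * e ^ 16 - 18277802400 * e ^ 14 + 2653694294592 * e ^ 12 - 228265955202560 * e ^ 10 + 12548530286529024 * e ^ 8 - 399323835588894720 * e ^ 6 + 6128923901873242112 * e ^ 4 - 30257631738174504960 * e ^ 2 + 63372450823299072000) / 1073741824) * X ^ 3 +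
      C ((5827965 * e ^ 17 - 1944991620 * e ^ 15 + 270966035472 * e ^ 13 - 20794775452480 * e ^ 11 + 949901590681344 * e ^ 9 - 24846006287846400 * e ^ 7 + 318505921601253376 * e ^ 5 - 1260734655757271040 * e ^ 3) / 134217728) * X ^ 2 +
      C ((165125675 * e ^ 18 - 54011786400 * e ^ 16 + 7314540467520 * e ^ 14 - 535883346634240 * e ^ 12 + 23459458113298944 * e ^ 10 - 643419304028037120 * e ^ 8 + 11113610858344300544 * e ^ 6 - 110944649706639851520 * e ^ 4 + 463016815977747382272 * e ^ 2 - 565569429923325542400) / 4294967296) * X +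
      C ((147744025 * e ^ 19 - 47556194400 * e ^ 17 + 6304718946240 * e ^ 15 - 448127328197120 * e ^ 13 + 18631982447433216 * e ^ 11 - 462353070042685440 * e ^ 9 + 6651922642769526784 * e ^ 7 - 50429386230290841600 * e ^ 5 + 154338938659249127424 * e ^ 3) / 4294967296),
      ?_, ?_, ?_, ?_⟩
  · compute_degree!
  · compute_degree
  · refine Polynomial.funext fun x => ?_
    rw [eval_centeredProd]
    simp only [Finset.prod_range_succ, Finset.prod_range_zero, eval_add, eval_mul, eval_sub,
      eval_pow, eval_C, eval_X, Nat.reduceMul, Nat.reduceAdd]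
    push_cast
    ring
  · intro he
    obtain ⟨i, hi, rfl⟩ := exists_of_eval_centeredProd_eq_zero he
    clear he
    refine le_trans (by norm_num) (le_natDegree_of_ne_zero (n := 9) ?_)
    simp only [coeff_add, coeff_C_mul, coeff_X_pow, coeff_X, coeff_C]
    interval_cases i <;> norm_num

theorem no_polynomial_solutions_k_in_9_to_19
    (k : ℕ) (hk : k ∈ ({9, 11, 13, 15, 17, 19} : Set ℕ)) :
    ¬ ∃ f₁ f₂ : Polynomial ℚ, f₁.natDegree = 2 ∧ f₂.natDegree = k ∧
      polyBinom f₁ k + polyBinom X 2 = polyBinom f₂ 2 := by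
  rintro ⟨f₁, f₂, h₁, h₂, h⟩
  simp only [Set.mem_insert_iff, Set.mem_singleton_iff] at hk
  rcases hk with rfl | rfl | rfl | rfl | rfl | rfl
  · exact polyBinom_add_polyBinom_X_ne (by norm_num) exists_centeredProd_four_eq h₁ h₂ h
  · exact polyBinom_add_polyBinom_X_ne (by norm_num) exists_centeredProd_five_eq h₁ h₂ h
  · exact polyBinom_add_polyBinom_X_ne (by norm_num) exists_centeredProd_six_eq h₁ h₂ h
  · exact polyBinom_add_polyBinom_X_ne (by norm_num) exists_centeredProd_seven_eq h₁ h₂ h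
  · exact polyBinom_add_polyBinom_X_ne (by norm_num) exists_centeredProd_eight_eq h₁ h₂ h
  · exact polyBinom_add_polyBinom_X_ne (by norm_num) exists_centeredProd_nine_eq h₁ h₂ h
end

section
/- Let k be an odd integer with 3 ≤ k ≤ 19. Then there are no polynomials f₁, f₂ ∈ ℚ[X] with deg f₁ = 2 and deg f₂ = k satisfying the polynomial identity B(f₁,k) − B(X,2) = B(f₂,2) in ℚ[X]. -/
open Polynomial

theorem PadicInt.factorial_dvd_prod_sub (p : ℕ) [Fact p.Prime] (k : ℕ) (z : ℤ_[p]) :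
    (k.factorial : ℤ_[p]) ∣ ∏ i ∈ Finset.range k, (z - (i : ℤ_[p])) := by
  refine ⟨Ring.choose z k, ?_⟩
  have h := Ring.descPochhammer_eq_factorial_smul_choose z k
  rw [nsmul_eq_mul] at h
  rw [← h, ← descPochhammer_eval_eq_prod_range, ← descPochhammer_map (Int.castRingHom ℤ_[p]),
    eval_map, smeval_def, eval₂_eq_sum]
  simp [Polynomial.sum, Polynomial.smul_pow]

theorem Padic.norm_sub_natCast_of_one_lt (p : ℕ) [Fact p.Prime] {x : ℚ_[p]} (hx : 1 < ‖x‖)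
    (i : ℕ) : ‖x - (i : ℚ_[p])‖ = ‖x‖ := by
  have hi : ‖(-(i : ℤ) : ℚ_[p])‖ < ‖x‖ := by
    rw [norm_neg]
    exact (Padic.norm_int_le_one i).trans_lt hx
  rw [Int.cast_natCast] at hi
  rw [sub_eq_add_neg, Padic.add_eq_max_of_ne hi.ne', max_eq_left hi.le]

/-- The binomial coefficient `B(x,k)` of a 2-adic number `x` never equals `-1/4` for `k ≥ 3`. -/
theorem Padic.four_mul_prod_sub_ne_neg_factorial {k : ℕ} (hk : 3 ≤ k) (x : ℚ_[2]) :
    4 * ∏ i ∈ Finset.range k, (x - (i : ℚ_[2])) ≠ -(k.factorial : ℚ_[2]) := by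
  intro h
  have h4 : ‖(4 : ℚ_[2])‖ = 1 / 4 := by
    have := Padic.norm_p_pow (p := 2) 2
    norm_num at this
    norm_num [this]
  rcases le_or_gt ‖x‖ 1 with hx | hx
  · obtain ⟨c, hc⟩ := PadicInt.factorial_dvd_prod_sub 2 k ⟨x, hx⟩
    have hc' := congrArg PadicInt.Coe.ringHom hc
    simp only [map_prod, map_mul, map_natCast] at hc'
    change ∏ i ∈ Finset.range k, (x - (i : ℚ_[2])) = _ * (c : ℚ_[2]) at hc'
    rw [hc'] at h
    have hf : (k.factorial : ℚ_[2]) ≠ 0 := Nat.cast_ne_zero.mpr k.factorial_ne_zero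
    have h1 : (4 : ℚ_[2]) * c = -1 := by
      apply mul_left_cancel₀ hf
      linear_combination h
    have h2 := congrArg norm h1
    rw [norm_mul, h4, norm_neg, norm_one] at h2
    have := c.norm_le_one
    rw [PadicInt.norm_def] at this
    linarith
  · have hx2 : 2 ≤ ‖x‖ := by
      by_contra! hlt
      have := (Padic.norm_lt_pow_iff_norm_le_pow_sub_one x 1).mp (by simpa using hlt)
      norm_num at this
      linarith
    have h2 := congrArg norm h
    rw [norm_mul, h4, norm_prod, Finset.prod_congr rfl
      fun i _ => Padic.norm_sub_natCast_of_one_lt 2 hx i, norm_neg] at h2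
    have hf := Padic.norm_int_le_one (p := 2) k.factorial
    rw [Int.cast_natCast, ← h2, Finset.prod_const, Finset.card_range] at hf
    have h3 : (2 : ℝ) ^ 3 ≤ ‖x‖ ^ k :=
      (pow_le_pow_right₀ (by norm_num) hk).trans (pow_le_pow_left₀ (by norm_num) hx2 k)
    linarith

theorem polyBinom_eval (f : ℚ[X]) (k : ℕ) (x : ℚ) :
    (polyBinom f k).eval x =
      (k.factorial : ℚ)⁻¹ * ∏ i ∈ Finset.range k, (f.eval x - (i : ℚ)) := by
  simp [polyBinom, eval_prod]

theorem polyBinom_eval_ne_neg_one_fourth {k : ℕ} (hk : 3 ≤ k) (f : ℚ[X]) (x : ℚ) :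
    (polyBinom f k).eval x ≠ -1 / 4 := by
  intro h
  rw [polyBinom_eval] at h
  have hf : (k.factorial : ℚ) ≠ 0 := Nat.cast_ne_zero.mpr k.factorial_ne_zero
  field_simp at h
  apply Padic.four_mul_prod_sub_ne_neg_factorial hk ((f.eval x : ℚ) : ℚ_[2])
  have h' := congrArg (Rat.cast : ℚ → ℚ_[2]) h
  push_cast at h'
  linear_combination h'

/-- A quadratic is invariant under the reflection in its axis of symmetry. -/
theorem exists_eval_sub_eq_of_natDegree_eq_two {f : ℚ[X]} (hf : f.natDegree = 2) :
    ∃ s : ℚ, ∀ x, f.eval (s - x) = f.eval x := by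
  have ha : f.coeff 2 ≠ 0 := by
    rw [← hf]
    exact leadingCoeff_ne_zero.mpr (ne_zero_of_natDegree_gt (hf ▸ Nat.zero_lt_two))
  refine ⟨-f.coeff 1 / f.coeff 2, fun x => ?_⟩
  simp only [eval_eq_sum_range, hf, Finset.sum_range_succ, Finset.sum_range_zero]
  field_simp
  ring

/-- If `g` has odd degree at least 3 and `g² - (g ∘ (s - X))²` is at most linear, then `g` is
antisymmetric about `s / 2`. -/
theorem comp_sub_X_eq_neg {g : ℚ[X]} (hodd : Odd g.natDegree) (hg : 2 ≤ g.natDegree) (s : ℚ)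
    (h : (g ^ 2 - (g.comp (C s - X)) ^ 2).natDegree ≤ 1) : g.comp (C s - X) = -g := by
  have hq : (C s - X : ℚ[X]).natDegree = 1 := by
    rw [← natDegree_neg, neg_sub, natDegree_X_sub_C]
  have hl : (C s - X : ℚ[X]).leadingCoeff = -1 := by
    rw [← neg_sub, leadingCoeff_neg, leadingCoeff_X_sub_C]
  have hg0 : g ≠ 0 := ne_zero_of_natDegree_gt hg
  have hne : g - g.comp (C s - X) ≠ 0 := by
    intro h0
    have h1 := congrArg leadingCoeff (sub_eq_zero.mp h0)
    rw [leadingCoeff_comp (by rw [hq]; exact one_ne_zero), hl, hodd.neg_one_pow] at h1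
    have := leadingCoeff_ne_zero.mpr hg0
    exact this (by linarith)
  by_contra hcon
  have hne' : g + g.comp (C s - X) ≠ 0 := fun h0 => hcon (eq_neg_of_add_eq_zero_right h0)
  rw [sq_sub_sq, natDegree_mul hne' hne] at h
  have h2 : (C 2 * g : ℚ[X]).natDegree ≤ 1 := by
    have e : C 2 * g = (g + g.comp (C s - X)) + (g - g.comp (C s - X)) := by
      rw [C_ofNat]
      ring
    rw [e]
    exact (natDegree_add_le _ _).trans (by omega)
  rw [natDegree_C_mul two_ne_zero] at h2
  omega

theorem no_polynomial_solutions_minus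
    (k : ℕ) (hodd : Odd k) (hk3 : 3 ≤ k) (hk19 : k ≤ 19) :
    ¬ ∃ f₁ f₂ : Polynomial ℚ, f₁.natDegree = 2 ∧ f₂.natDegree = k ∧
      polyBinom f₁ k - polyBinom X 2 = polyBinom f₂ 2 := by
  rintro ⟨f₁, f₂, h₁, h₂, h⟩
  obtain ⟨s, hs⟩ := exists_eval_sub_eq_of_natDegree_eq_two h₁
  have hsB (x : ℚ) : (polyBinom f₁ k).eval (s - x) = (polyBinom f₁ k).eval x := by
    simp only [polyBinom_eval, hs]
  have hsq (x : ℚ) :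
      (2 * f₂.eval x - 1) ^ 2 = 8 * (polyBinom f₁ k).eval x + 2 - (2 * x - 1) ^ 2 := by
    have e := congrArg (eval x) h
    rw [eval_sub, polyBinom_eval X, polyBinom_eval f₂] at e
    simp [Finset.prod_range_succ] at e
    linear_combination -8 * e
  set g : ℚ[X] := C 2 * f₂ - C 1 with hgdef
  have hg : g.natDegree = k := by
    rw [hgdef, natDegree_sub_C, natDegree_C_mul two_ne_zero, h₂]
  have hgx (x : ℚ) : g.eval x = 2 * f₂.eval x - 1 := by simp [hgdef]
  have hdiff : g ^ 2 - (g.comp (C s - X)) ^ 2 =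
      C (8 * (1 - s)) * X + C (4 * s * (s - 1)) := by
    refine Polynomial.funext fun x => ?_
    simp only [eval_sub, eval_pow, eval_comp, eval_C, eval_X, eval_add, eval_mul, hgx, hsq, hsB]
    ring
  have hanti := comp_sub_X_eq_neg (hg ▸ hodd) (by omega) s (hdiff ▸ natDegree_linear_le)
  have hs1 : s = 1 := by
    rw [hanti, neg_sq, sub_self] at hdiff
    have e₀ := congrArg (eval 0) hdiff
    have e₁ := congrArg (eval 1) hdiff
    simp only [eval_zero, eval_add, eval_mul, eval_C, eval_X] at e₀ e₁
    linarith
  subst hs1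
  have hg0 := congrArg (eval (1 / 2 : ℚ)) hanti
  simp only [eval_comp, eval_sub, eval_C, eval_X, eval_neg] at hg0
  norm_num only at hg0
  have hhalf := hsq (1 / 2)
  rw [← hgx] at hhalf
  have hz : g.eval (1 / 2 : ℚ) = 0 := by linarith
  rw [hz] at hhalf
  exact polyBinom_eval_ne_neg_one_fourth hk3 f₁ (1 / 2) (by linarith)
end

section
/- Let k be an odd integer with 5 ≤ k ≤ 19. Then there are no polynomials f₀, f₁, f₂ ∈ ℚ[X] with deg f₀ = 2, deg f₁ = 2 and deg f₂ = k satisfying the polynomial identity B(f₁,k) + B(f₀,2) = B(f₂,2) in ℚ[X]. -/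
open Polynomial

section Descent

/-- The coprimality of `m, n` and `r, s` and the identity `r * s = m * n` split the four numbers into
pairwise products. -/
theorem exists_four_factors {m n r s : ℤ} (hm : m ≠ 0) (h : r * s = m * n) :
    ∃ α β γ δ : ℤ, r = α * β ∧ m = α * γ ∧ s = γ * δ ∧ n = β * δ ∧ IsCoprime β γ := by
  obtain ⟨g, γ, β, hcop, hγ, hβ⟩ : ∃ g γ β : ℤ, IsCoprime γ β ∧ m = γ * g ∧ r = β * g := by
    obtain ⟨γ, β, hg, h1, h2⟩ :=
      Int.exists_gcd_one (m := m) (n := r) (Int.gcd_pos_of_ne_zero_left _ hm)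
    exact ⟨_, γ, β, Int.isCoprime_iff_gcd_eq_one.2 hg, h1, h2⟩
  have hg : g ≠ 0 := by rintro rfl; simp at hγ; exact hm hγ
  have hγ0 : γ ≠ 0 := by rintro rfl; simp at hγ; exact hm hγ
  have h1 : β * s = γ * n := by
    apply mul_left_cancel₀ hg
    rw [hγ, hβ] at h
    linear_combination h
  obtain ⟨δ, hδ⟩ : γ ∣ s := hcop.dvd_of_dvd_mul_left ⟨n, h1⟩
  refine ⟨g, β, γ, δ, by rw [hβ]; ring, by rw [hγ]; ring, hδ, ?_, hcop.symm⟩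
  apply mul_left_cancel₀ hγ0
  rw [← h1, hδ]; ring

theorem not_three_dvd_sq_add_sq {x y : ℤ} (h : IsCoprime x y) : ¬ (3 : ℤ) ∣ x ^ 2 + y ^ 2 := by
  intro hd
  have key : (3 : ℤ) ∣ x ∧ (3 : ℤ) ∣ y := by
    have hx : x % 3 = 0 ∨ x % 3 = 1 ∨ x % 3 = 2 := by omega
    have hy : y % 3 = 0 ∨ y % 3 = 1 ∨ y % 3 = 2 := by omega
    have hd' := Int.emod_eq_zero_of_dvd hd
    rcases hx with hx | hx | hx <;> rcases hy with hy | hy | hy <;>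
      simp [pow_two, Int.add_emod, Int.mul_emod, hx, hy] at hd'
    omega
  have := h.isUnit_of_dvd' key.1 key.2
  rw [Int.isUnit_iff] at this
  omega

theorem dvd_three_of_dvd_three_mul_sq {k x y : ℤ} (h : IsCoprime x y) (hx : k ∣ 3 * x ^ 2)
    (hy : k ∣ 3 * y ^ 2) : k ∣ 3 := by
  obtain ⟨a, b, hab⟩ := (h.pow (m := 2) (n := 2))
  have : (3 : ℤ) = a * (3 * x ^ 2) + b * (3 * y ^ 2) := by linear_combination (-3) * hab
  rw [this]
  exact (hx.mul_left a).add (hy.mul_left b)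

theorem eq_one_or_three_of_dvd_three {k : ℤ} (hk : 0 < k) (h : k ∣ 3) : k = 1 ∨ k = 3 := by
  have := Int.le_of_dvd (by norm_num) h
  interval_cases k <;> omega

/-- The descent step for `x ^ 2 + y ^ 2` and `x ^ 2 + 4 * y ^ 2`, on the parametrizations of the two
Pythagorean triples. -/
theorem descent_step {m n r s : ℤ} (hm : m ≠ 0) (hn : n ≠ 0) (hrs : IsCoprime r s)
    (hmul : r * s = 2 * (m * n)) (hsub : m ^ 2 - n ^ 2 = r ^ 2 - s ^ 2) :
    ∃ x y u v : ℤ, x ≠ 0 ∧ y ≠ 0 ∧ x ^ 2 + y ^ 2 = u ^ 2 ∧ x ^ 2 + 4 * y ^ 2 = v ^ 2 ∧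
      x * y ∣ m * n := by
  have h2 : (2 : ℤ) ∣ r ∨ (2 : ℤ) ∣ s := Int.prime_two.dvd_or_dvd ⟨_, hmul⟩
  rcases h2 with ⟨r', rfl⟩ | ⟨s', rfl⟩
  · obtain ⟨α, β, γ, δ, rfl, rfl, rfl, rfl, hc⟩ :=
      exists_four_factors (r := r') (s := s) hm (by linarith)
    simp only [ne_eq, mul_eq_zero, not_or] at hm hn
    have hαδ : IsCoprime α δ :=
      (hrs.of_isCoprime_of_dvd_left ⟨2 * β, by ring⟩).of_isCoprime_of_dvd_right ⟨γ, by ring⟩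
    have he : α ^ 2 * (4 * β ^ 2 - γ ^ 2) = δ ^ 2 * (γ ^ 2 - β ^ 2) := by
      linear_combination -hsub
    obtain ⟨k, hk⟩ : α ^ 2 ∣ γ ^ 2 - β ^ 2 :=
      (hαδ.pow (m := 2) (n := 2)).dvd_of_dvd_mul_left ⟨_, he.symm⟩
    have hk' : 4 * β ^ 2 - γ ^ 2 = δ ^ 2 * k := by
      apply mul_left_cancel₀ (pow_ne_zero 2 hm.1)
      rw [he, hk]; ring
    have hβ : 3 * β ^ 2 = k * (α ^ 2 + δ ^ 2) := by linear_combination hk + hk'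
    have hγ : 3 * γ ^ 2 = k * (4 * α ^ 2 + δ ^ 2) := by linear_combination 4 * hk + hk'
    have hα2 : 0 < α ^ 2 := by have := hm.1; positivity
    have hβ2 : 0 < β ^ 2 := by have := hn.1; positivity
    have hkpos : 0 < k := by
      by_contra! hneg
      nlinarith [sq_nonneg δ]
    rcases eq_one_or_three_of_dvd_three hkpos
      (dvd_three_of_dvd_three_mul_sq hc ⟨_, hβ⟩ ⟨_, hγ⟩) with rfl | rfl
    · exact absurd ⟨β ^ 2, by linarith⟩ (not_three_dvd_sq_add_sq hαδ)
    · exact ⟨δ, α, β, γ, hn.2, hm.1, by linarith, by linarith, ⟨β * γ, by ring⟩⟩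
  · obtain ⟨α, β, γ, δ, rfl, rfl, rfl, rfl, hc⟩ :=
      exists_four_factors (r := s') (s := r) hm (by linarith)
    simp only [ne_eq, mul_eq_zero, not_or] at hm hn
    have hαδ : IsCoprime α δ :=
      ((hrs.of_isCoprime_of_dvd_left (Dvd.intro_left γ rfl)).of_isCoprime_of_dvd_right
        ⟨2 * β, by ring⟩).symm
    have he : α ^ 2 * (γ ^ 2 + 4 * β ^ 2) = δ ^ 2 * (γ ^ 2 + β ^ 2) := by
      linear_combination hsub
    obtain ⟨k, hk⟩ : α ^ 2 ∣ γ ^ 2 + β ^ 2 :=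
      (hαδ.pow (m := 2) (n := 2)).dvd_of_dvd_mul_left ⟨_, he.symm⟩
    have hk' : γ ^ 2 + 4 * β ^ 2 = δ ^ 2 * k := by
      apply mul_left_cancel₀ (pow_ne_zero 2 hm.1)
      rw [he, hk]; ring
    have hβ : 3 * β ^ 2 = k * (δ ^ 2 - α ^ 2) := by linear_combination hk' - hk
    have hγ : 3 * γ ^ 2 = k * (4 * α ^ 2 - δ ^ 2) := by linear_combination 4 * hk - hk'
    have hα2 : 0 < α ^ 2 := by have := hm.1; positivity
    have hβ2 : 0 < β ^ 2 := by have := hn.1; positivity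
    have hkpos : 0 < k := by
      by_contra! hneg
      nlinarith [sq_nonneg γ]
    rcases eq_one_or_three_of_dvd_three hkpos
      (dvd_three_of_dvd_three_mul_sq hc ⟨_, hβ⟩ ⟨_, hγ⟩) with rfl | rfl
    · exact ⟨γ, β, α, δ, hm.2, hn.1, by linarith, by linarith, ⟨α * δ, by ring⟩⟩
    · exact absurd ⟨α ^ 2, by linarith⟩ (not_three_dvd_sq_add_sq hc.symm)

theorem not_sq_add_sq_and_sq_add_four_mul_sq (x y u v : ℤ) (hx : x ≠ 0) (hy : y ≠ 0)
    (hu : x ^ 2 + y ^ 2 = u ^ 2) (hv : x ^ 2 + 4 * y ^ 2 = v ^ 2) : False := by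
  induction hN : (x * y).natAbs using Nat.strong_induction_on generalizing x y u v with
  | _ N ih =>
  subst hN
  have smaller : ∀ x' y' c : ℤ, 2 ≤ c.natAbs → x' ≠ 0 → y' ≠ 0 → x * y = c * (x' * y') →
      (x' * y').natAbs < (x * y).natAbs := by
    intro x' y' c hc hx' hy' h
    rw [h, Int.natAbs_mul c]
    have h1 : 0 < (x' * y').natAbs := Int.natAbs_pos.2 (mul_ne_zero hx' hy')
    nlinarith
  by_cases hg : Int.gcd x y = 1
  · rcases Int.even_or_odd x with ⟨x', rfl⟩ | hodd
    · have hx' : x' ≠ 0 := by omega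
      have : Even v := by
        have : Even (v ^ 2) := ⟨2 * x' ^ 2 + 2 * y ^ 2, by linarith⟩
        exact (Int.even_pow.1 this).1
      obtain ⟨v', rfl⟩ := this
      exact ih _ (smaller y x' 2 (by norm_num) hy hx' (by ring)) y x' v' u hy hx' (by linarith)
        (by linarith) rfl
    · have hx2 : x % 2 = 1 := Int.odd_iff.1 hodd
      have hypos : 0 < y ^ 2 := by positivity
      have hu0 : u ≠ 0 := by
        rintro rfl
        nlinarith [sq_nonneg x]
      have hv0 : v ≠ 0 := by
        rintro rfl
        nlinarith [sq_nonneg x]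
      have hy2 : y % 2 = 0 := by
        by_contra hy2
        have hx4 := Int.sq_mod_four_eq_one_of_odd hodd
        have hy4 := Int.sq_mod_four_eq_one_of_odd (Int.odd_iff.2 (by omega : y % 2 = 1))
        rcases Int.even_or_odd u with ⟨w, rfl⟩ | hu'
        · ring_nf at hu hx4 hy4
          omega
        · have hu4 := Int.sq_mod_four_eq_one_of_odd hu'
          omega
      have hcop : IsCoprime x y := Int.isCoprime_iff_gcd_eq_one.2 hg
      have hcop2 : IsCoprime x (2 * y) := by
        refine IsCoprime.mul_right ?_ hcop
        exact ⟨1, -(x / 2), by omega⟩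
      obtain ⟨m, n, hxm, hym, -⟩ := PythagoreanTriple.coprime_classification'
        (x := x) (y := y) (z := |u|) (by
          simp only [PythagoreanTriple, abs_mul_abs_self]; linarith) hg hx2 (abs_pos.2 hu0)
      obtain ⟨r, s, hxr, hyr, -, hrs, -⟩ := PythagoreanTriple.coprime_classification'
        (x := x) (y := 2 * y) (z := |v|) (by
          simp only [PythagoreanTriple, abs_mul_abs_self]; linarith)
        (Int.isCoprime_iff_gcd_eq_one.1 hcop2) hx2 (abs_pos.2 hv0)
      have hm : m ≠ 0 := by rintro rfl; simp at hym; exact hy hym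
      have hn : n ≠ 0 := by rintro rfl; simp at hym; exact hy hym
      obtain ⟨x', y', u', v', hx', hy', hu', hv', t, ht⟩ := descent_step hm hn
        (Int.isCoprime_iff_gcd_eq_one.2 hrs) (by linarith) (hxm.symm.trans hxr)
      have ht0 : t ≠ 0 := by rintro rfl; simp [hm, hn] at ht
      refine ih _ (smaller x' y' (2 * (x * t)) ?_ hx' hy' ?_) x' y' u' v' hx' hy' hu' hv' rfl
      · have : x * t ≠ 0 := mul_ne_zero hx ht0
        omega
      · rw [hym]
        linear_combination 2 * x * ht
  · have hgpos : 0 < Int.gcd x y := Int.gcd_pos_of_ne_zero_left _ hx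
    obtain ⟨x', y', -, hx', hy'⟩ := Int.exists_gcd_one hgpos
    generalize Int.gcd x y = g at *
    have hg0 : (g : ℤ) ≠ 0 := by omega
    have hgu : (g : ℤ) ∣ u := (Int.pow_dvd_pow_iff two_ne_zero).1
      ⟨x' ^ 2 + y' ^ 2, by rw [← hu, hx', hy']; ring⟩
    have hgv : (g : ℤ) ∣ v := (Int.pow_dvd_pow_iff two_ne_zero).1
      ⟨x' ^ 2 + 4 * y' ^ 2, by rw [← hv, hx', hy']; ring⟩
    obtain ⟨u', rfl⟩ := hgu
    obtain ⟨v', rfl⟩ := hgv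
    have hx0 : x' ≠ 0 := by rintro rfl; simp at hx'; exact hx hx'
    have hy0 : y' ≠ 0 := by rintro rfl; simp at hy'; exact hy hy'
    refine ih _ (smaller x' y' (g ^ 2) ?_ hx0 hy0 ?_) x' y' u' v' hx0 hy0 ?_ ?_ rfl
    · rw [Int.natAbs_pow, Int.natAbs_natCast]
      have : 2 ≤ g := by omega
      nlinarith
    · rw [hx', hy']; ring
    · apply mul_left_cancel₀ (pow_ne_zero 2 hg0)
      rw [hx', hy'] at hu
      linear_combination hu
    · apply mul_left_cancel₀ (pow_ne_zero 2 hg0)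
      rw [hx', hy'] at hv
      linear_combination hv

theorem Rat.not_sq_add_sq_and_sq_add_four_mul_sq (x y u v : ℚ) (hx : x ≠ 0) (hy : y ≠ 0)
    (hu : x ^ 2 + y ^ 2 = u ^ 2) (hv : x ^ 2 + 4 * y ^ 2 = v ^ 2) : False := by
  have clear : ∀ {q : ℚ} {d : ℤ}, (∃ z : ℤ, q * d = z) → ∀ e : ℤ, ∃ z : ℤ, q * (d * e : ℤ) = z := by
    rintro q d ⟨z, hz⟩ e
    exact ⟨z * e, by push_cast; rw [← mul_assoc, hz]⟩
  have den : ∀ q : ℚ, ∃ z : ℤ, q * (q.den : ℤ) = z := fun q => ⟨q.num, by simp⟩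
  obtain ⟨d, hd, ⟨x', hx'⟩, ⟨y', hy'⟩, ⟨u', hu'⟩, ⟨v', hv'⟩⟩ : ∃ d : ℤ, d ≠ 0 ∧
      (∃ z : ℤ, x * d = z) ∧ (∃ z : ℤ, y * d = z) ∧ (∃ z : ℤ, u * d = z) ∧
      (∃ z : ℤ, v * d = z) := by
    refine ⟨x.den * (y.den * (u.den * v.den)), by simp, clear (den x) _, ?_, ?_, ?_⟩
    · convert clear (den y) (x.den * (u.den * v.den)) using 5
      ring
    · convert clear (den u) (x.den * (y.den * v.den)) using 5
      ring
    · convert clear (den v) (x.den * (y.den * u.den)) using 5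
      ring
  have hdq : (d : ℚ) ≠ 0 := by exact_mod_cast hd
  refine _root_.not_sq_add_sq_and_sq_add_four_mul_sq x' y' u' v' ?_ ?_ ?_ ?_
  · exact_mod_cast hx' ▸ mul_ne_zero hx hdq
  · exact_mod_cast hy' ▸ mul_ne_zero hy hdq
  · have : (x' : ℚ) ^ 2 + (y' : ℚ) ^ 2 = (u' : ℚ) ^ 2 := by
      rw [← hx', ← hy', ← hu']
      linear_combination (d : ℚ) ^ 2 * hu
    exact_mod_cast this
  · have : (x' : ℚ) ^ 2 + 4 * (y' : ℚ) ^ 2 = (v' : ℚ) ^ 2 := by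
      rw [← hx', ← hy', ← hv']
      linear_combination (d : ℚ) ^ 2 * hv
    exact_mod_cast this

theorem Rat.sq_ne_two_mul_sq {x y : ℚ} (hy : y ≠ 0) : x ^ 2 ≠ 2 * y ^ 2 := by
  intro h
  have : IsSquare (2 : ℚ) := ⟨x / y, by field_simp; linarith⟩
  have : IsSquare (2 : ℕ) := by
    rw [← Rat.isSquare_natCast_iff]
    exact_mod_cast this
  exact Nat.prime_two.prime.irreducible.not_isSquare this

/-- **Fermat's four squares theorem**: four rational squares in arithmetic progression are equal. -/
theorem Rat.four_squares_arith_prog {a b c d D : ℚ} (hb : b ^ 2 = a ^ 2 + D)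
    (hc : c ^ 2 = a ^ 2 + 2 * D) (hd : d ^ 2 = a ^ 2 + 3 * D) : D = 0 := by
  by_contra hD
  have hb0 : b ≠ 0 := by
    rintro rfl
    rcases lt_or_gt_of_ne hD with h | h <;> nlinarith [sq_nonneg a, sq_nonneg c, sq_nonneg d]
  have hc0 : c ≠ 0 := by
    rintro rfl
    rcases lt_or_gt_of_ne hD with h | h <;> nlinarith [sq_nonneg a, sq_nonneg b, sq_nonneg d]
  have ha0 : a ≠ 0 := by
    rintro rfl
    exact Rat.sq_ne_two_mul_sq (x := c) hb0 (by linarith)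
  have hd0 : d ≠ 0 := by
    rintro rfl
    exact Rat.sq_ne_two_mul_sq (x := b) hc0 (by linarith)
  have ha : a ^ 2 = 2 * b ^ 2 - c ^ 2 := by linarith
  have hd' : d ^ 2 = 2 * c ^ 2 - b ^ 2 := by linarith
  have hX : (2 * (a * b * c * d)) ^ 2 =
      4 * ((2 * b ^ 2 - c ^ 2) * b ^ 2 * c ^ 2 * (2 * c ^ 2 - b ^ 2)) := by
    rw [← ha, ← hd']; ring
  refine Rat.not_sq_add_sq_and_sq_add_four_mul_sq (2 * (a * b * c * d)) (c ^ 4 - b ^ 4)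
    (((b ^ 2 + c ^ 2) ^ 2 - 3 * (c ^ 2 - b ^ 2) ^ 2) / 2)
    (((b ^ 2 + c ^ 2) ^ 2 + 3 * (c ^ 2 - b ^ 2) ^ 2) / 2) (by positivity) ?_ ?_ ?_
  · have h1 : c ^ 4 - b ^ 4 = D * (b ^ 2 + c ^ 2) := by
      linear_combination (b ^ 2 + c ^ 2) * (hc - hb)
    rw [h1]
    positivity
  · rw [hX]; ring
  · rw [hX]; ring

end Descent

section Polynomials

theorem natDegree_C_sub_X (h : ℚ) : (C h - X : ℚ[X]).natDegree = 1 := by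
  rw [← natDegree_neg, neg_sub, natDegree_X_sub_C]

theorem leadingCoeff_C_sub_X (h : ℚ) : (C h - X : ℚ[X]).leadingCoeff = -1 := by
  rw [← neg_sub, leadingCoeff_neg, leadingCoeff_X_sub_C]

theorem polyBinom_comp (f q : ℚ[X]) (k : ℕ) : (polyBinom f k).comp q = polyBinom (f.comp q) k := by
  simp [polyBinom, Polynomial.prod_comp]

theorem polyBinom_two (f : ℚ[X]) : 8 * polyBinom f 2 = (2 * f - 1) ^ 2 - 1 := by
  have h : (8 : ℚ[X]) * C (1 / 2) = 4 := by
    rw [← map_ofNat C 8, ← map_ofNat C 4, ← C_mul]; norm_num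
  simp only [polyBinom, Finset.prod_range_succ, Finset.prod_range_zero, Nat.factorial]
  norm_num
  rw [← mul_assoc, h]
  ring

/-- If `b ^ 2 - a ^ 2` is invariant under the reflection `X ↦ h - X`, where `a` is quadratic and `b`
has odd degree at least five, then `b` is odd and `a` is even. -/
theorem comp_reflection_of_sq_sub_sq {a b : ℚ[X]} {h : ℚ} {k : ℕ} (hk : Odd k) (hk5 : 5 ≤ k)
    (ha : a.natDegree = 2) (hb : b.natDegree = k)
    (hab : (b ^ 2 - a ^ 2).comp (C h - X) = b ^ 2 - a ^ 2) :
    b.comp (C h - X) = -b ∧ a.comp (C h - X) = a := by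
  have hcoeff (p : ℚ[X]) : (p.comp (C h - X)).coeff p.natDegree =
      p.leadingCoeff * (-1) ^ p.natDegree := by
    rw [← leadingCoeff_C_sub_X h, ← leadingCoeff_comp (by rw [natDegree_C_sub_X]; norm_num),
      leadingCoeff, natDegree_comp, natDegree_C_sub_X, mul_one]
  have hadeg : (a.comp (C h - X)).natDegree = 2 := by
    rw [natDegree_comp, natDegree_C_sub_X, ha]
  have hbco := hcoeff b
  have haco := hcoeff a
  have ha0 : a.leadingCoeff ≠ 0 := leadingCoeff_ne_zero.2 (by rintro rfl; simp at ha)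
  have hb0 : b.leadingCoeff ≠ 0 := leadingCoeff_ne_zero.2 (by rintro rfl; simp at hb; omega)
  simp only [sub_comp, pow_comp] at hab
  set a' := a.comp (C h - X)
  set b' := b.comp (C h - X)
  have hprod : (b - b') * (b + b') = (a - a') * (a + a') := by linear_combination -hab
  have hdiff : (b - b').coeff k ≠ 0 := by
    rw [coeff_sub, ← hb, hbco, hb, hk.neg_one_pow, ← hb, coeff_natDegree]
    intro h0
    exact hb0 (by linarith)
  have hsum : b + b' = 0 := by
    by_contra hne
    have h1 : k ≤ (b - b').natDegree := le_natDegree_of_ne_zero hdiff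
    have h2 : ((b - b') * (b + b')).natDegree ≤ 4 := by
      rw [hprod]
      exact natDegree_mul_le_of_le (natDegree_sub_le_of_le ha.le hadeg.le)
        (natDegree_add_le_of_degree_le ha.le hadeg.le)
    rw [natDegree_mul (by intro h0; simp [h0] at hdiff) hne] at h2
    omega
  refine ⟨(neg_eq_of_add_eq_zero_right hsum).symm, ?_⟩
  rw [hsum, mul_zero, eq_comm, mul_eq_zero] at hprod
  rcases hprod with h0 | h0
  · exact (sub_eq_zero.1 h0).symm
  · exfalso
    have := congrArg (fun p => coeff p 2) h0
    rw [ha] at haco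
    simp only [coeff_add, haco, coeff_zero] at this
    rw [leadingCoeff, ha] at this ha0
    exact ha0 (by linarith)

/-- Each factor `f - i` of `polyBinom f k` has a rational root once `polyBinom f k` is, up to a scalar,
a product of two polynomials exchanged up to sign by a reflection fixing `f`. -/
theorem exists_eval_eq_of_mul_eq_polyBinom {f G H : ℚ[X]} {h c : ℚ} {k i : ℕ} (hc : c ≠ 0)
    (hf : f.natDegree = 2) (hfh : f.comp (C h - X) = f) (hGh : G.comp (C h - X) = -H)
    (hHh : H.comp (C h - X) = -G) (hGH : G * H = C c * ∏ i ∈ Finset.range k, (f - (i : ℚ[X])))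
    (hi : i < k) : ∃ x : ℚ, f.eval x = i := by
  by_contra! hroot
  set P : ℚ[X] := f - (i : ℚ[X]) with hP
  have hdeg (j : ℕ) : (f - (j : ℚ[X])).natDegree = 2 := by
    rw [← C_eq_natCast, natDegree_sub_C, hf]
  have hirr : Irreducible P := by
    refine irreducible_of_degree_le_three_of_not_isRoot ?_ fun x hx => hroot x ?_
    · simp [hP, hdeg]
    · simpa [hP, sub_eq_zero] using hx
  have hPh : P.comp (C h - X) = P := by simp [hP, hfh]
  have hdvd {Q R : ℚ[X]} (hQ : Q.comp (C h - X) = -R) (hPQ : P ∣ Q) : P ∣ R := by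
    obtain ⟨S, rfl⟩ := hPQ
    rw [mul_comp, hPh] at hQ
    exact (dvd_neg (α := ℚ[X])).1 ⟨_, hQ.symm⟩
  have hi' := Finset.mem_range.2 hi
  have hsplit := Finset.mul_prod_erase (Finset.range k) (fun j : ℕ => f - (j : ℚ[X])) hi'
  have hboth : P ∣ G ∧ P ∣ H := by
    have : P ∣ G * H := by
      rw [hGH, ← hsplit]
      exact (dvd_mul_right _ _).mul_left _
    rcases hirr.prime.dvd_or_dvd this with h1 | h1
    · exact ⟨h1, hdvd hGh h1⟩
    · exact ⟨hdvd hHh h1, h1⟩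
  have hsq := mul_dvd_mul hboth.1 hboth.2
  rw [hGH, ← hsplit, mul_left_comm, mul_dvd_mul_iff_left hirr.ne_zero,
    (isUnit_C.2 hc.isUnit).dvd_mul_left, hirr.prime.dvd_finsetProd_iff] at hsq
  obtain ⟨j, hj, hPj⟩ := hsq
  have hd : P ∣ C ((i : ℚ) - j) := by
    have := dvd_sub hPj dvd_rfl
    convert this using 1
    simp [hP]
  have hne : (i : ℚ) - j ≠ 0 :=
    sub_ne_zero.2 (by exact_mod_cast (Finset.ne_of_mem_erase hj).symm)
  have := natDegree_le_of_dvd hd (C_ne_zero.2 hne)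
  rw [natDegree_C, hdeg] at this
  omega

end Polynomials

theorem no_polynomial_solutions_general_quadratic
    (k : ℕ) (hodd : Odd k) (hk5 : 5 ≤ k) (hk19 : k ≤ 19) :
    ¬ ∃ f₀ f₁ f₂ : Polynomial ℚ, f₀.natDegree = 2 ∧ f₁.natDegree = 2 ∧
      f₂.natDegree = k ∧
      polyBinom f₁ k + polyBinom f₀ 2 = polyBinom f₂ 2 := by
  rintro ⟨f₀, f₁, f₂, h₀, h₁, h₂, heq⟩
  obtain ⟨A, B, E, hA, hf⟩ : ∃ A B E : ℚ, A ≠ 0 ∧ f₁ = C A * X ^ 2 + C B * X + C E :=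
    ⟨_, _, _, by rw [← h₁]; exact leadingCoeff_ne_zero.2 (by rintro rfl; simp at h₁),
      eq_quadratic_of_degree_le_two (natDegree_le_iff_degree_le.1 h₁.le)⟩
  have hfh : f₁.comp (C (-B / A) - X) = f₁ := by
    have hAB : C A * C (-B / A) = -C B := by
      rw [← C_mul, ← C_neg]; congr 1; field_simp
    simp only [hf, add_comp, mul_comp, C_comp, pow_comp, X_comp]
    linear_combination (C (-B / A) - 2 * X) * hAB
  have hdeg (f : ℚ[X]) : (2 * f - 1).natDegree = f.natDegree := by
    rw [← C_1, natDegree_sub_C, ← map_ofNat C 2, natDegree_C_mul two_ne_zero]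
  have hsq : (2 * f₂ - 1) ^ 2 - (2 * f₀ - 1) ^ 2 = 8 * polyBinom f₁ k := by
    linear_combination polyBinom_two f₀ - polyBinom_two f₂ - 8 * heq
  obtain ⟨hb, ha⟩ := comp_reflection_of_sq_sub_sq (a := 2 * f₀ - 1) (b := 2 * f₂ - 1)
    (h := -B / A) hodd hk5 (by rw [hdeg, h₀]) (by rw [hdeg, h₂])
    (by rw [hsq, mul_comp, polyBinom_comp, hfh, ofNat_comp]; rfl)
  have hsquare (i : ℕ) (hi : i < k) : ∃ w : ℚ, w ^ 2 = B ^ 2 - 4 * A * E + i * (4 * A) := by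
    obtain ⟨x, hx⟩ := exists_eval_eq_of_mul_eq_polyBinom (f := f₁)
      (G := (2 * f₂ - 1) - (2 * f₀ - 1)) (H := (2 * f₂ - 1) + (2 * f₀ - 1))
      (c := 8 * (k.factorial : ℚ)⁻¹) (by positivity) h₁ hfh
      (by rw [sub_comp, hb, ha]; ring) (by rw [add_comp, hb, ha]; ring)
      (by rw [C_mul, map_ofNat, mul_assoc, ← polyBinom]; linear_combination hsq) hi
    refine ⟨2 * A * x + B, ?_⟩
    simp only [hf, eval_add, eval_mul, eval_C, eval_pow, eval_X] at hx
    linear_combination 4 * A * hx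
  obtain ⟨a, ha⟩ := hsquare 0 (by omega)
  obtain ⟨b, hb⟩ := hsquare 1 (by omega)
  obtain ⟨c, hc⟩ := hsquare 2 (by omega)
  obtain ⟨d, hd⟩ := hsquare 3 (by omega)
  push_cast at ha hb hc hd
  have := Rat.four_squares_arith_prog (a := a) (b := b) (c := c) (d := d) (D := 4 * A)
    (by linarith) (by linarith) (by linarith)
  exact hA (by linarith)
end
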